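/- Let Λ_b and Λ_w be partitions of n with (n − l(Λ_b)) + (n − l(Λ_w)) = n − 1. Let S⁺ be the set of real polynomials of the form P = X^n + a₂X^{n−2} + ⋯ + a_n whose ramification type at 0 is Λ_b and at 1 is Λ_w, and let S⁻ be the set of real polynomials of the form P = −X^n + a₂X^{n−2} + ⋯ + a_n whose ramification type at 0 is Λ_b and at 1 is Λ_w. Then both sets are finite and the signed counts coincide: Σ_{P∈S⁺} ε(P) = Σ_{P∈S⁻} ε(P). (This is the polynomial reformulation of the invariance theorem for black and white real trees: the signed number of white side trees equals the signed number of black side trees with black vertex degrees Λ_b and white vertex degrees Λ_w.) -/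

import Mathlib

open Polynomial
open scoped Classical

/-- The ramification type of `w` for a real polynomial `P`: the multiset of
multiplicities of the complex roots of `P - w`. -/
noncomputable def ramType (P : Polynomial ℝ) (w : ℝ) : Multiset ℕ :=
  ((P.map (algebraMap ℝ ℂ) - Polynomial.C (w : ℂ)).roots.toFinset.val).map
    fun z => (P.map (algebraMap ℝ ℂ) - Polynomial.C (w : ℂ)).rootMultiplicity z

/-- A disorder of `P`: a pair `x₁ < x₂` with `P x₁ = P x₂` and the multiplicity of `x₁`
as a root of `P - P x₁` strictly greater than that of `x₂`. -/
def disorders (P : Polynomial ℝ) : Set (ℝ × ℝ) :=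
  {p | p.1 < p.2 ∧ P.eval p.1 = P.eval p.2 ∧
    (P - Polynomial.C (P.eval p.2)).rootMultiplicity p.2
      < (P - Polynomial.C (P.eval p.1)).rootMultiplicity p.1}

/-- The sign `ε(P) = (-1)^{number of disorders}`. -/
noncomputable def epsilonP (P : Polynomial ℝ) : ℤ := (-1) ^ Nat.card (disorders P)

/-- `P = X^n + a₂ X^(n-2) + ⋯ + a_n`: monic of degree `n` with vanishing coefficient
of `X^(n-1)`. -/
def IsNormalized (n : ℕ) (P : Polynomial ℝ) : Prop :=
  P.natDegree = n ∧ P.Monic ∧ P.coeff (n - 1) = 0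

/-- A multiset of positive integers summing to `n`. -/
def IsPartitionOf (n : ℕ) (Λ : Multiset ℕ) : Prop := Λ.sum = n ∧ 0 ∉ Λ

set_option linter.unusedSectionVars false

namespace TreeInv

/-! ### Part 1 : Piola identity -/

theorem derivation_prod {R K κ : Type*} [CommRing R] [CommRing K] [Algebra R K] [DecidableEq κ]
    (D : Derivation R K K) (s : Finset κ) (f : κ → K) :
    D (∏ i ∈ s, f i) = ∑ i ∈ s, (∏ j ∈ s.erase i, f j) * D (f i) := by
  induction s using Finset.induction_on with
  | empty => simp
  | insert a s ha ih =>
    rw [Finset.prod_insert ha, D.leibniz, ih, Finset.sum_insert ha, Finset.erase_insert ha]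
    simp only [smul_eq_mul]
    rw [add_comm, Finset.mul_sum]
    congr 1
    apply Finset.sum_congr rfl
    intro i hi
    have hia : i ≠ a := fun h => ha (h ▸ hi)
    rw [Finset.erase_insert_of_ne hia.symm, Finset.prod_insert (by simp [ha]), mul_assoc]

theorem derivation_det {R K κ : Type*} [CommRing R] [CommRing K] [Algebra R K] [Fintype κ]
    [DecidableEq κ] (D : Derivation R K K) (M : Matrix κ κ K) :
    D M.det = ∑ k, (M.updateRow k fun l => D (M k l)).det := by
  have key : ∀ M : Matrix κ κ K, M.det = ∑ σ : Equiv.Perm κ,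
      Equiv.Perm.sign σ • ∏ i, M i (σ i) := by
    intro M
    rw [← Matrix.det_transpose, Matrix.det_apply]
    rfl
  simp_rw [key]
  rw [map_sum, Finset.sum_comm]
  apply Finset.sum_congr rfl
  intro σ _
  rw [← Finset.smul_sum]
  have : D (Equiv.Perm.sign σ • ∏ i, M i (σ i)) = Equiv.Perm.sign σ • D (∏ i, M i (σ i)) := by
    rcases Int.units_eq_one_or (Equiv.Perm.sign σ) with h | h <;> simp [h]
  rw [this, derivation_prod]
  congr 1
  apply Finset.sum_congr rfl
  intro k _
  rw [← Finset.prod_erase_mul Finset.univ _ (Finset.mem_univ k)]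
  congr 1
  · apply Finset.prod_congr rfl
    intro j hj
    rw [Matrix.updateRow_ne (Finset.ne_of_mem_erase hj)]
  · simp

variable {ι : Type*} [Fintype ι] [DecidableEq ι]

theorem pderiv_comm (i j : ι) (p : MvPolynomial ι ℝ) :
    MvPolynomial.pderiv i (MvPolynomial.pderiv j p) =
      MvPolynomial.pderiv j (MvPolynomial.pderiv i p) := by
  induction p using MvPolynomial.induction_on with
  | C a => simp
  | add p q hp hq => simp [hp, hq]
  | mul_X p k hp =>
    simp only [Derivation.leibniz, smul_eq_mul, map_add, hp, MvPolynomial.pderiv_X]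
    simp only [Pi.single_apply]
    split_ifs <;> simp <;> ring

/-- Jacobian matrix. -/
noncomputable def jacM (H : ι → MvPolynomial ι ℝ) : Matrix ι ι (MvPolynomial ι ℝ) :=
  Matrix.of fun i j => MvPolynomial.pderiv j (H i)

theorem piola (H : ι → MvPolynomial ι ℝ) (i : ι) :
    ∑ j, MvPolynomial.pderiv j ((jacM H).adjugate j i) = 0 := by
  set M := jacM H with hM
  let Δ : ι → ι → ι → MvPolynomial ι ℝ := fun k j l =>
    ((M.updateRow i (Pi.single j 1)).updateRow k (Pi.single l 1)).det
  let P : ι → ι → ι → MvPolynomial ι ℝ := fun k j l =>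
    MvPolynomial.pderiv j (MvPolynomial.pderiv l (H k))
  have h1 : ∀ j, MvPolynomial.pderiv j (M.adjugate j i) =
      ∑ k ∈ Finset.univ.erase i, ∑ l, P k j l * Δ k j l := by
    intro j
    rw [Matrix.adjugate_apply, derivation_det, ← Finset.add_sum_erase _ _ (Finset.mem_univ i)]
    have hz : ((M.updateRow i (Pi.single j 1)).updateRow i fun l =>
        MvPolynomial.pderiv j ((M.updateRow i (Pi.single j 1)) i l)).det = 0 := by
      apply Matrix.det_eq_zero_of_row_eq_zero i
      intro l
      simp only [Matrix.updateRow_self, Pi.single_apply]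
      split_ifs <;> simp
    rw [hz, zero_add]
    apply Finset.sum_congr rfl
    intro k hk
    have hki := Finset.ne_of_mem_erase hk
    have hrow : (fun l => MvPolynomial.pderiv j ((M.updateRow i (Pi.single j 1)) k l)) =
        ∑ l, P k j l • (Pi.single l 1 : ι → MvPolynomial ι ℝ) := by
      funext l
      rw [Matrix.updateRow_ne hki]
      simp [P, hM, jacM, Finset.sum_apply, Pi.single_apply]
    rw [hrow]
    have := (Matrix.detRowAlternating (n := ι) (R := MvPolynomial ι ℝ)).map_update_sum
      Finset.univ k (fun l => P k j l • (Pi.single l 1 : ι → MvPolynomial ι ℝ))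
      (M.updateRow i (Pi.single j 1))
    refine this.trans ?_
    apply Finset.sum_congr rfl
    intro l _
    exact (Matrix.detRowAlternating (n := ι) (R := MvPolynomial ι ℝ)).map_update_smul
      (M.updateRow i (Pi.single j 1)) k (P k j l) (Pi.single l 1)
  simp_rw [h1]
  rw [Finset.sum_comm]
  apply Finset.sum_eq_zero
  intro k hk
  have hki := Finset.ne_of_mem_erase hk
  have hanti : ∀ j l, Δ k l j = - Δ k j l := by
    intro j l
    have : ((M.updateRow i (Pi.single l 1)).updateRow k (Pi.single j 1)) =
      ((M.updateRow i (Pi.single j 1)).updateRow k (Pi.single l 1)).submatrix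
        (Equiv.swap i k) id := by
      ext a b
      simp only [Matrix.submatrix_apply, id]
      by_cases ha : a = i
      · subst ha
        rw [Equiv.swap_apply_left, Matrix.updateRow_ne hki.symm]
        simp
      · by_cases hk' : a = k
        · subst hk'
          rw [Equiv.swap_apply_right, Matrix.updateRow_self, Matrix.updateRow_ne hki.symm]
          simp
        · rw [Equiv.swap_apply_of_ne_of_ne ha hk', Matrix.updateRow_ne hk', Matrix.updateRow_ne ha,
            Matrix.updateRow_ne hk', Matrix.updateRow_ne ha]
    simp only [Δ]
    rw [this, Matrix.det_permute, Equiv.Perm.sign_swap hki.symm]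
    simp
  have hS : ∑ j, ∑ l, P k j l * Δ k j l = - ∑ j, ∑ l, P k j l * Δ k j l := by
    conv_lhs => rw [Finset.sum_comm]
    simp_rw [← Finset.sum_neg_distrib]
    apply Finset.sum_congr rfl
    intro j _
    apply Finset.sum_congr rfl
    intro l _
    rw [hanti j l]
    simp only [P]
    rw [pderiv_comm]
    ring
  exact self_eq_neg.mp hS

theorem hasStrictFDerivAt_eval (p : MvPolynomial ι ℝ) (x : ι → ℝ) :
    HasStrictFDerivAt (fun x => MvPolynomial.eval x p)
      (∑ i, MvPolynomial.eval x (MvPolynomial.pderiv i p) •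
        (ContinuousLinearMap.proj i : (ι → ℝ) →L[ℝ] ℝ)) x := by
  induction p using MvPolynomial.induction_on with
  | C a => simpa using hasStrictFDerivAt_const a x
  | add p q hp hq =>
    have e : (fun x => MvPolynomial.eval x (p + q)) =
        (fun x => MvPolynomial.eval x p) + fun x => MvPolynomial.eval x q := by
      funext x; simp
    rw [e]
    refine (hp.add hq).congr_fderiv ?_
    simp [add_smul, Finset.sum_add_distrib]
  | mul_X p k hp =>
    have hX : HasStrictFDerivAt (fun x : ι → ℝ => x k)
      (ContinuousLinearMap.proj k : (ι → ℝ) →L[ℝ] ℝ) x :=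
      (ContinuousLinearMap.proj (R := ℝ) (φ := fun _ : ι => ℝ) k).hasStrictFDerivAt
    have e : (fun x => MvPolynomial.eval x (p * MvPolynomial.X k)) =
        (fun x => MvPolynomial.eval x p) * fun x : ι → ℝ => x k := by
      funext x; simp
    rw [e]
    refine (hp.mul hX).congr_fderiv ?_
    · simp only [Derivation.leibniz, smul_eq_mul, map_add, map_mul, MvPolynomial.eval_X,
        MvPolynomial.pderiv_X, add_smul, Finset.sum_add_distrib, Finset.smul_sum, smul_smul]
      congr 1
      rw [Finset.sum_eq_single k]
      · simp
      · intro b _ hb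
        simp [Pi.single_apply, hb.symm]
      · simp

end TreeInv

namespace TreeInv
variable {ι : Type*} [Fintype ι] [DecidableEq ι]

/-- The polynomial map. -/
noncomputable def hmap (H : ι → MvPolynomial ι ℝ) (x : ι → ℝ) : ι → ℝ :=
  fun i => MvPolynomial.eval x (H i)

/-- Jacobian matrix at a point. -/
noncomputable def jacX (H : ι → MvPolynomial ι ℝ) (x : ι → ℝ) : Matrix ι ι ℝ :=
  Matrix.of fun i j => MvPolynomial.eval x (MvPolynomial.pderiv j (H i))

/-- Jacobian determinant at a point. -/
noncomputable def jac (H : ι → MvPolynomial ι ℝ) (x : ι → ℝ) : ℝ := (jacX H x).det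

theorem jac_eq_eval (H : ι → MvPolynomial ι ℝ) (x : ι → ℝ) :
    jac H x = MvPolynomial.eval x (jacM H).det := by
  rw [RingHom.map_det]
  rfl

/-- derivative of the polynomial map. -/
noncomputable def hder (H : ι → MvPolynomial ι ℝ) (x : ι → ℝ) : (ι → ℝ) →L[ℝ] (ι → ℝ) :=
  LinearMap.toContinuousLinearMap (Matrix.toLin' (jacX H x))

theorem hder_det (H : ι → MvPolynomial ι ℝ) (x : ι → ℝ) : (hder H x).det = jac H x := by
  simp [hder, ContinuousLinearMap.det, jac]

theorem hmap_strict (H : ι → MvPolynomial ι ℝ) (x : ι → ℝ) :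
    HasStrictFDerivAt (hmap H) (hder H x) x := by
  rw [hasStrictFDerivAt_pi']
  intro i
  refine (hasStrictFDerivAt_eval (H i) x).congr_fderiv ?_
  ext v
  simp [hder, jacX, Matrix.mulVec, dotProduct]

theorem hmap_cont (H : ι → MvPolynomial ι ℝ) : Continuous (hmap H) :=
  continuous_pi fun i => MvPolynomial.continuous_eval (H i)

theorem jac_cont (H : ι → MvPolynomial ι ℝ) : Continuous (jac H) := by
  have : jac H = fun x => MvPolynomial.eval x (jacM H).det := funext (jac_eq_eval H)
  rw [this]
  exact MvPolynomial.continuous_eval _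

theorem sign_mul_abs' (r : ℝ) : Real.sign r * |r| = r := by
  rcases lt_trichotomy r 0 with h | h | h
  · rw [Real.sign_of_neg h, abs_of_neg h]; ring
  · simp [h]
  · rw [Real.sign_of_pos h, abs_of_pos h]; ring

open MeasureTheory in
theorem local_degree (H : ι → MvPolynomial ι ℝ)
    (hp : ∀ R, Bornology.IsBounded {x | ‖hmap H x‖ ≤ R}) (y : ι → ℝ)
    (hreg : ∀ x, hmap H x = y → jac H x ≠ 0) :
    ∃ hF : {x | hmap H x = y}.Finite, ∃ δ > 0, ∀ g : (ι → ℝ) → ℝ, Integrable g →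
      (∀ z, g z ≠ 0 → dist z y < δ) →
      Integrable (fun x => g (hmap H x) * jac H x) ∧
      ∫ x, g (hmap H x) * jac H x = (∑ x ∈ hF.toFinset, Real.sign (jac H x)) * ∫ z, g z := by
  set F := {x | hmap H x = y} with hFdef
  have hloc : ∀ x ∈ F, ∃ U : Set (ι → ℝ), IsOpen U ∧ x ∈ U ∧ Set.InjOn (hmap H) U ∧
      ∀ z ∈ U, Real.sign (jac H z) = Real.sign (jac H x) := by
    intro x hx
    have hJ := hreg x hx
    have hdet : (hder H x).det ≠ 0 := by rwa [hder_det]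
    have hs : HasStrictFDerivAt (hmap H)
      ((hder H x).toContinuousLinearEquivOfDetNeZero hdet : (ι → ℝ) →L[ℝ] (ι → ℝ)) x := by
      simpa using hmap_strict H x
    let φ := hs.toOpenPartialHomeomorph (hmap H)
    have hφ : (φ : (ι → ℝ) → (ι → ℝ)) = hmap H := hs.toOpenPartialHomeomorph_coe
    refine ⟨φ.source ∩ {z | 0 < jac H z * jac H x}, φ.open_source.inter ?_,
      ⟨hs.mem_toOpenPartialHomeomorph_source, ?_⟩, ?_, ?_⟩
    · exact isOpen_lt continuous_const ((jac_cont H).mul continuous_const)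
    · exact mul_self_pos.mpr hJ
    · rw [← hφ]; exact φ.injOn.mono Set.inter_subset_left
    · rintro z ⟨-, hz⟩
      have hz' : 0 < jac H z * jac H x := hz
      rcases pos_and_pos_or_neg_and_neg_of_mul_pos hz' with ⟨h1, h2⟩ | ⟨h1, h2⟩
      · rw [Real.sign_of_pos h1, Real.sign_of_pos h2]
      · rw [Real.sign_of_neg h1, Real.sign_of_neg h2]
  have hopen : ∀ x ∈ F, ∀ U : Set (ι → ℝ), IsOpen U → x ∈ U →
      hmap H '' U ∈ nhds y := by
    intro x hx U hU hxU
    have hJ := hreg x hx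
    have hdet : (hder H x).det ≠ 0 := by rwa [hder_det]
    have hs : HasStrictFDerivAt (hmap H)
      ((hder H x).toContinuousLinearEquivOfDetNeZero hdet : (ι → ℝ) →L[ℝ] (ι → ℝ)) x := by
      simpa using hmap_strict H x
    have := hs.map_nhds_eq_of_equiv
    have hx' : hmap H x = y := hx
    rw [← hx', ← this]
    exact Filter.image_mem_map (hU.mem_nhds hxU)
  have hcompact : ∀ R, IsCompact {x | ‖hmap H x‖ ≤ R} := fun R =>
    Metric.isCompact_of_isClosed_isBounded
      (isClosed_le (hmap_cont H).norm continuous_const) (hp R)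
  have hFc : IsCompact F := by
    refine (hcompact ‖y‖).of_isClosed_subset (isClosed_eq (hmap_cont H) continuous_const) ?_
    intro x hx
    have hx' : hmap H x = y := hx
    simp [hx']
  choose! U hUo hUx hUi hUs using hloc
  have hFin : F.Finite := by
    obtain ⟨t, ht⟩ := hFc.elim_nhds_subcover' (fun x hx => U x)
      (fun x hx => (hUo x hx).mem_nhds (hUx x hx))
    refine (t.finite_toSet.image Subtype.val).subset ?_
    intro z hz
    obtain ⟨x, hx, hzx⟩ := Set.mem_iUnion₂.mp (ht hz)
    refine ⟨x, hx, ?_⟩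
    exact hUi x x.2 (hUx x x.2) hzx (by
      have h1 : hmap H x = y := x.2
      have h2 : hmap H z = y := hz
      rw [h1, h2])
  obtain ⟨V, hV, hVd⟩ := hFin.t2_separation
  let W : (ι → ℝ) → Set (ι → ℝ) := fun x => U x ∩ V x
  have hWo : ∀ x ∈ F, IsOpen (W x) := fun x hx => (hUo x hx).inter (hV x).2
  have hWx : ∀ x ∈ F, x ∈ W x := fun x hx => ⟨hUx x hx, (hV x).1⟩
  have hWi : ∀ x ∈ F, Set.InjOn (hmap H) (W x) := fun x hx =>
    (hUi x hx).mono Set.inter_subset_left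
  let K := {x | ‖hmap H x‖ ≤ ‖y‖ + 1} \ ⋃ x ∈ F, W x
  have hKc : IsCompact K := (hcompact _).diff (isOpen_biUnion hWo)
  have hKy : (hmap H '' K)ᶜ ∈ nhds y := by
    refine (hKc.image (hmap_cont H)).isClosed.isOpen_compl.mem_nhds ?_
    rintro ⟨x, hxK, hxy⟩
    exact hxK.2 (Set.mem_biUnion (show x ∈ F from hxy) (hWx x hxy))
  have hI : (⋂ x ∈ F, hmap H '' (W x)) ∈ nhds y :=
    (Filter.biInter_mem hFin).mpr fun x hx => hopen x hx _ (hWo x hx) (hWx x hx)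
  obtain ⟨δ, hδ, hball⟩ := Metric.mem_nhds_iff.mp
    (Filter.inter_mem (Filter.inter_mem hKy hI) (Metric.ball_mem_nhds y one_pos))
  refine ⟨hFin, δ, hδ, ?_⟩
  intro g hg hsupp
  have hzero : ∀ x, x ∉ ⋃ x ∈ F, W x → g (hmap H x) * jac H x = 0 := by
    intro x hx
    by_contra hne
    have hg0 : g (hmap H x) ≠ 0 := left_ne_zero_of_mul hne
    have hd := hball (Metric.mem_ball.mpr (hsupp _ hg0))
    refine hd.1.1 ⟨x, ⟨?_, hx⟩, rfl⟩
    have := Metric.mem_ball.mp hd.2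
    rw [dist_eq_norm] at this
    have h2 := norm_sub_norm_le (hmap H x) y
    simp only [Set.mem_ofPred_eq]
    linarith
  have hder' : ∀ x ∈ F, ∀ z ∈ W x, HasFDerivWithinAt (hmap H) (hder H z) (W x) z :=
    fun x _ z _ => (hmap_strict H z).hasFDerivAt.hasFDerivWithinAt
  have hpt : ∀ x ∈ F, ∀ z ∈ W x, g (hmap H z) * jac H z =
      Real.sign (jac H x) * (|(hder H z).det| • g (hmap H z)) := by
    intro x hx z hz
    rw [hder_det, ← hUs x hx z hz.1, smul_eq_mul, ← mul_assoc, sign_mul_abs', mul_comm]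
  have hint : ∀ x ∈ F, IntegrableOn (fun z => g (hmap H z) * jac H z) (W x) := by
    intro x hx
    have := (integrableOn_image_iff_integrableOn_abs_det_fderiv_smul volume
      (hWo x hx).measurableSet (hder' x hx) (hWi x hx) g).mp hg.integrableOn
    have h2 : IntegrableOn (fun z => Real.sign (jac H x) *
        (|(hder H z).det| • g (hmap H z))) (W x) := this.const_mul _
    exact h2.congr_fun (fun z hz => (hpt x hx z hz).symm) (hWo x hx).measurableSet
  have hval : ∀ x ∈ F, ∫ z in W x, g (hmap H z) * jac H z = Real.sign (jac H x) * ∫ z, g z := by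
    intro x hx
    rw [setIntegral_congr_fun (hWo x hx).measurableSet (hpt x hx), integral_const_mul,
      ← integral_image_eq_integral_abs_det_fderiv_smul volume (hWo x hx).measurableSet
        (hder' x hx) (hWi x hx) g, setIntegral_eq_integral_of_forall_compl_eq_zero]
    intro z hz
    by_contra hne
    have hd := hball (Metric.mem_ball.mpr (hsupp _ hne))
    exact hz (Set.mem_iInter₂.mp hd.1.2 x hx)
  have hFU : (⋃ x ∈ F, W x) = ⋃ x ∈ hFin.toFinset, W x := by simp
  rw [hFU] at hzero
  have hmeas : MeasurableSet (⋃ x ∈ hFin.toFinset, W x) := by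
    rw [← hFU]; exact (isOpen_biUnion hWo).measurableSet
  constructor
  · have : IntegrableOn (fun z => g (hmap H z) * jac H z) (⋃ x ∈ hFin.toFinset, W x) :=
      integrableOn_finset_iUnion.mpr fun x hx => hint x (hFin.mem_toFinset.mp hx)
    exact (integrableOn_iff_integrable_of_support_subset (by
      intro x hx
      by_contra hxn
      exact hx (hzero x hxn))).mp this
  · rw [← setIntegral_eq_integral_of_forall_compl_eq_zero hzero, integral_biUnion_finset,
      Finset.sum_mul]
    · exact Finset.sum_congr rfl fun x hx => hval x (hFin.mem_toFinset.mp hx)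
    · exact fun x hx => (hWo x (hFin.mem_toFinset.mp hx)).measurableSet
    · intro x hx z hz hxz
      have h1 : x ∈ F := by simpa using hx
      have h2 : z ∈ F := by simpa using hz
      exact (hVd h1 h2 hxz).mono Set.inter_subset_right Set.inter_subset_right
    · exact fun x hx => hint x (hFin.mem_toFinset.mp hx)

end TreeInv

namespace TreeInv
variable {ι : Type*} [Fintype ι] [DecidableEq ι]

open MeasureTheory in
theorem integral_fderiv_zero (f : (ι → ℝ) → ℝ) (hf : ContDiff ℝ 1 f) (hc : HasCompactSupport f)
    (v : ι → ℝ) : Integrable (fun x => fderiv ℝ f x v) ∧ ∫ x, fderiv ℝ f x v = 0 := by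
  have hi : Integrable (fun x => fderiv ℝ f x v) := by
    apply Continuous.integrable_of_hasCompactSupport
    · exact (hf.continuous_fderiv one_ne_zero).clm_apply continuous_const
    · exact hc.fderiv_apply ℝ v
  refine ⟨hi, ?_⟩
  have := integral_mul_fderiv_eq_neg_fderiv_mul_of_integrable (μ := volume) (𝕜 := ℝ)
    (f := fun _ : ι → ℝ => (1 : ℝ)) (g := f) (v := v) (by simp) (by simpa using hi)
    (by simpa using hf.continuous.integrable_of_hasCompactSupport hc)
    (fun x _ => differentiableAt_const _) (fun x _ => hf.differentiable one_ne_zero x)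
  simpa using this

theorem contDiff_eval (p : MvPolynomial ι ℝ) (n : WithTop ℕ∞) :
    ContDiff ℝ n (fun x : ι → ℝ => MvPolynomial.eval x p) :=
  (AnalyticOnNhd.eval_mvPolynomial p).contDiff

open MeasureTheory in
theorem divergence_zero (H : ι → MvPolynomial ι ℝ)
    (hp : ∀ R, Bornology.IsBounded {x | ‖hmap H x‖ ≤ R}) (i0 : ι)
    (Φ : (ι → ℝ) → ℝ) (hΦ : ContDiff ℝ 1 Φ) (R : ℝ) (hR : ∀ z, Φ z ≠ 0 → ‖z‖ ≤ R) :
    ∫ x, (fderiv ℝ Φ (hmap H x) (Pi.single i0 1)) * jac H x = 0 := by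
  let c : ι → MvPolynomial ι ℝ := fun j => (jacM H).adjugate j i0
  let f : ι → (ι → ℝ) → ℝ := fun j x => Φ (hmap H x) * MvPolynomial.eval x (c j)
  have hh : ContDiff ℝ 1 (hmap H) := contDiff_pi.mpr fun i => contDiff_eval (H i) 1
  have hf : ∀ j, ContDiff ℝ 1 (f j) := fun j => (hΦ.comp hh).mul (contDiff_eval _ 1)
  have hcomp : IsCompact {x | ‖hmap H x‖ ≤ R} :=
    Metric.isCompact_of_isClosed_isBounded
      (isClosed_le (hmap_cont H).norm continuous_const) (hp R)
  have hc : ∀ j, HasCompactSupport (f j) := by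
    intro j
    refine HasCompactSupport.of_support_subset_isCompact hcomp ?_
    intro x hx
    exact hR _ (left_ne_zero_of_mul hx)
  have hpoint : ∀ x, (fderiv ℝ Φ (hmap H x) (Pi.single i0 1)) * jac H x =
      ∑ j, fderiv ℝ (f j) x (Pi.single j 1) := by
    intro x
    have hd : ∀ j, fderiv ℝ (f j) x (Pi.single j 1) =
        Φ (hmap H x) * MvPolynomial.eval x (MvPolynomial.pderiv j (c j)) +
        MvPolynomial.eval x (c j) *
          fderiv ℝ Φ (hmap H x) (hder H x (Pi.single j 1)) := by
      intro j
      have h1 : HasFDerivAt (fun x => Φ (hmap H x))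
          ((fderiv ℝ Φ (hmap H x)).comp (hder H x)) x :=
        ((hΦ.differentiable one_ne_zero (hmap H x)).hasFDerivAt).comp x
          (hmap_strict H x).hasFDerivAt
      have h2 := (hasStrictFDerivAt_eval (c j) x).hasFDerivAt
      have h3 := (h1.mul h2).fderiv
      have h4 : f j = (fun x => Φ (hmap H x)) * (fun x => MvPolynomial.eval x (c j)) := rfl
      rw [h4, h3]
      simp [Pi.single_apply]
    simp_rw [hd]
    rw [Finset.sum_add_distrib, ← Finset.mul_sum, ← map_sum, piola, map_zero, mul_zero, zero_add]
    have : ∑ j, MvPolynomial.eval x (c j) *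
          fderiv ℝ Φ (hmap H x) (hder H x (Pi.single j 1)) =
        fderiv ℝ Φ (hmap H x) (hder H x (∑ j, MvPolynomial.eval x (c j) • Pi.single j 1)) := by
      simp [map_sum]
    rw [this]
    have h5 : hder H x (∑ j, MvPolynomial.eval x (c j) • Pi.single j 1) =
        jac H x • Pi.single i0 1 := by
      have e1 : (∑ j, MvPolynomial.eval x (c j) • (Pi.single j 1 : ι → ℝ)) =
          fun j => MvPolynomial.eval x (c j) := by
        funext k
        simp [Finset.sum_apply, Pi.single_apply]
      rw [e1]
      funext k
      have e2 := congrFun (congrFun (Matrix.mul_adjugate (jacM H)) k) i0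
      have e3 := congrArg (MvPolynomial.eval x) e2
      rw [Matrix.mul_apply, map_sum] at e3
      simp only [map_mul, Matrix.smul_apply, smul_eq_mul] at e3
      rw [← jac_eq_eval] at e3
      simp only [hder, LinearMap.coe_toContinuousLinearMap', Matrix.toLin'_apply, Matrix.mulVec,
        dotProduct, Pi.smul_apply, smul_eq_mul]
      refine Eq.trans ?_ (e3.trans ?_)
      · rfl
      · simp only [Matrix.one_apply, Pi.single_apply]
        split_ifs <;> simp
    rw [h5, map_smul, smul_eq_mul, mul_comm]
  simp_rw [hpoint]
  rw [integral_finsetSum]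
  · exact Finset.sum_eq_zero fun j _ => (integral_fderiv_zero (f j) (hf j) (hc j) _).2
  · exact fun j _ => (integral_fderiv_zero (f j) (hf j) (hc j) _).1

open MeasureTheory in
theorem degree_inv (H : ι → MvPolynomial ι ℝ) (i0 : ι)
    (hp : ∀ R, Bornology.IsBounded {x | ‖hmap H x‖ ≤ R})
    (hreg : ∀ s : ℝ, s ≠ 0 → ∀ x, hmap H x = Pi.single i0 s → jac H x ≠ 0) :
    ∃ (h1 : {x | hmap H x = Pi.single i0 1}.Finite)
      (h2 : {x | hmap H x = Pi.single i0 (-1)}.Finite),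
      ∑ x ∈ h1.toFinset, Real.sign (jac H x) = ∑ x ∈ h2.toFinset, Real.sign (jac H x) := by
  obtain ⟨h1, δ1, hδ1, hg1⟩ := local_degree H hp (Pi.single i0 1) (hreg 1 one_ne_zero)
  obtain ⟨h2, δ2, hδ2, hg2⟩ := local_degree H hp (Pi.single i0 (-1)) (hreg (-1) (by norm_num))
  refine ⟨h1, h2, ?_⟩
  obtain ⟨δ, hδ, hδ1', hδ2', hδ3⟩ : ∃ δ > 0, δ ≤ δ1 ∧ δ ≤ δ2 ∧ δ ≤ 1 :=
    ⟨min (min δ1 δ2) 1, by positivity, (min_le_left _ _).trans (min_le_left _ _),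
      (min_le_left _ _).trans (min_le_right _ _), min_le_right _ _⟩
  let χ : ContDiffBump (0 : ℝ) := ⟨δ / 4, δ / 2, by linarith, by linarith⟩
  let σ : ContDiffBump (0 : ℝ) := ⟨1 - δ / 2, 1 + δ / 2, by linarith, by linarith⟩
  have hσd : ∀ s, HasDerivAt σ (deriv σ s) s := fun s =>
    ((σ.contDiff (n := 1)).differentiable one_ne_zero s).hasDerivAt
  have hσs : ∀ s, deriv σ s ≠ 0 → 1 - δ / 2 ≤ |s| ∧ |s| ≤ 1 + δ / 2 := by
    intro s hs
    constructor
    · by_contra! hlt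
      apply hs
      have : (σ : ℝ → ℝ) =ᶠ[nhds s] fun _ => 1 :=
        σ.eventuallyEq_one_of_mem_ball (by simpa [σ] using hlt)
      rw [this.deriv_eq]; simp
    · by_contra! hlt
      apply hs
      have : (σ : ℝ → ℝ) =ᶠ[nhds s] fun _ => 0 := by
        have : ∀ᶠ u in nhds s, 1 + δ / 2 < |u| :=
          (isOpen_lt continuous_const continuous_abs).mem_nhds hlt
        filter_upwards [this] with u hu
        apply σ.zero_of_le_dist
        simpa [σ] using hu.le
      rw [this.deriv_eq]; simp
  have hχs : ∀ s, χ s ≠ 0 → |s| ≤ δ / 2 := by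
    intro s hs
    by_contra! hlt
    exact hs (χ.zero_of_le_dist (by simpa [χ] using hlt.le))
  have hσs' : ∀ s, σ s ≠ 0 → |s| ≤ 2 := by
    intro s hs
    by_contra! hlt
    refine hs (σ.zero_of_le_dist ?_)
    simp only [σ, dist_zero_right, Real.norm_eq_abs]
    linarith
  let Φ : (ι → ℝ) → ℝ := fun z => (∏ i ∈ Finset.univ.erase i0, χ (z i)) * σ (z i0)
  have hΦ : ContDiff ℝ 1 Φ := by
    apply ContDiff.mul
    · apply contDiff_prod
      intro i _
      exact χ.contDiff.comp (contDiff_apply ℝ ℝ i)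
    · exact σ.contDiff.comp (contDiff_apply ℝ ℝ i0)
  have hΦs : ∀ z, Φ z ≠ 0 → ‖z‖ ≤ 2 := by
    intro z hz
    rw [pi_norm_le_iff_of_nonneg (by norm_num)]
    intro i
    by_cases hi : i = i0
    · subst hi; exact hσs' _ (right_ne_zero_of_mul hz)
    · have := Finset.prod_ne_zero_iff.mp (left_ne_zero_of_mul hz) i (by simp [hi])
      have := hχs _ this
      rw [Real.norm_eq_abs]; linarith
  have hder : ∀ z, fderiv ℝ Φ z (Pi.single i0 1) =
      (∏ i ∈ Finset.univ.erase i0, χ (z i)) * deriv σ (z i0) := by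
    intro z
    have ha := (hΦ.differentiable one_ne_zero z).hasFDerivAt.hasLineDerivAt (Pi.single i0 1)
    have hb : HasLineDerivAt ℝ Φ
        ((∏ i ∈ Finset.univ.erase i0, χ (z i)) * deriv σ (z i0)) z (Pi.single i0 1) := by
      unfold HasLineDerivAt
      have he : (fun t : ℝ => Φ (z + t • Pi.single i0 1)) = fun t =>
          (∏ i ∈ Finset.univ.erase i0, χ (z i)) * σ (z i0 + t) := by
        funext t
        simp only [Φ]
        congr 1
        · apply Finset.prod_congr rfl
          intro i hi
          simp [Finset.ne_of_mem_erase hi]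
        · simp
      rw [he]
      apply HasDerivAt.const_mul
      have h0 : HasDerivAt σ (deriv σ (z i0)) (z i0 + 0) := by simpa using hσd (z i0)
      exact h0.comp_const_add (z i0) 0
    exact ha.unique hb
  let γ : Set ℝ → ι → ℝ → ℝ := fun S i s => if i = i0 then S.indicator (deriv σ) s else χ s
  let ψ : Set ℝ → (ι → ℝ) → ℝ := fun S z => ∏ i, γ S i (z i)
  have hψ : ∀ S z, ψ S z = (∏ i ∈ Finset.univ.erase i0, χ (z i)) * S.indicator (deriv σ) (z i0) := by
    intro S z
    simp only [ψ]
    rw [← Finset.prod_erase_mul Finset.univ _ (Finset.mem_univ i0)]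
    congr 1
    · apply Finset.prod_congr rfl
      intro i hi
      simp [γ, Finset.ne_of_mem_erase hi]
    · simp [γ]
  have hσ'c : Continuous (deriv σ) := (σ.contDiff (n := 1)).continuous_deriv (le_refl _)
  have hσ'i : Integrable (deriv σ) :=
    hσ'c.integrable_of_hasCompactSupport σ.hasCompactSupport.deriv
  have hψi : ∀ S, MeasurableSet S → Integrable (ψ S) := by
    intro S hS
    apply Integrable.fintype_prod
    intro i
    by_cases hi : i = i0
    · simp only [γ, hi, if_true]
      exact hσ'i.indicator hS
    · simp only [γ, hi, if_false]
      exact χ.continuous.integrable_of_hasCompactSupport χ.hasCompactSupport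
  set c : ℝ := ∏ i ∈ Finset.univ.erase i0, ∫ s, χ s with hcdef
  have hc : c ≠ 0 := Finset.prod_ne_zero_iff.mpr fun i _ => χ.integral_pos.ne'
  have hψv : ∀ S, MeasurableSet S → ∫ z, ψ S z = c * ∫ s in S, deriv σ s := by
    intro S hS
    rw [integral_fintype_prod_volume_eq_prod,
      ← Finset.prod_erase_mul Finset.univ _ (Finset.mem_univ i0)]
    congr 1
    · apply Finset.prod_congr rfl
      intro i hi
      simp [γ, Finset.ne_of_mem_erase hi]
    · simp only [γ, if_true]
      exact integral_indicator hS
  have hσ0 : σ 0 = 1 := σ.one_of_mem_closedBall (by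
    have : 0 ≤ 1 - δ / 2 := by linarith
    simpa [σ] using this)
  have htop : Filter.Tendsto σ Filter.atTop (nhds 0) := by
    apply tendsto_const_nhds.congr'
    filter_upwards [Filter.eventually_gt_atTop 2] with s hs
    by_contra hne
    have := hσs' s (Ne.symm hne)
    have := le_abs_self s
    linarith
  have hbot : Filter.Tendsto σ Filter.atBot (nhds 0) := by
    apply tendsto_const_nhds.congr'
    filter_upwards [Filter.eventually_lt_atBot (-2)] with s hs
    by_contra hne
    have := hσs' s (Ne.symm hne)
    have := neg_abs_le s
    linarith
  have hI1 : ∫ s in Set.Ioi 0, deriv σ s = -1 := by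
    rw [integral_Ioi_of_hasDerivAt_of_tendsto' (fun s _ => hσd s) hσ'i.integrableOn htop, hσ0]
    norm_num
  have hI2 : ∫ s in Set.Iic 0, deriv σ s = 1 := by
    rw [integral_Iic_of_hasDerivAt_of_tendsto' (fun s _ => hσd s) hσ'i.integrableOn hbot, hσ0]
    norm_num
  have hdist : ∀ (S : Set ℝ) (t : ℝ), (∀ s ∈ S, 1 - δ / 2 ≤ |s| → |s| ≤ 1 + δ / 2 → |s - t| ≤ δ / 2) →
      ∀ z, ψ S z ≠ 0 → dist z (Pi.single i0 t) < δ := by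
    intro S t hS z hz
    rw [hψ] at hz
    have h1 := left_ne_zero_of_mul hz
    have h2 := right_ne_zero_of_mul hz
    have h3 : dist z (Pi.single i0 t) ≤ δ / 2 := by
      rw [dist_pi_le_iff (by linarith)]
      intro i
      by_cases hi : i = i0
      · subst hi
        have hmem : z i ∈ S := by
          by_contra hn
          exact h2 (Set.indicator_of_notMem hn _)
        rw [Set.indicator_of_mem hmem] at h2
        have := hσs _ h2
        simpa [Real.dist_eq] using hS _ hmem this.1 this.2
      · have := hχs _ (Finset.prod_ne_zero_iff.mp h1 i (by simp [hi]))
        simpa [hi, Real.dist_eq] using this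
    linarith
  obtain ⟨i1, v1⟩ := hg1 (ψ (Set.Ioi 0)) (hψi _ measurableSet_Ioi) (fun z hz =>
    lt_of_lt_of_le (hdist _ 1 (by
      intro s hs ha hb
      have hs' : 0 < s := hs
      rw [abs_of_pos hs'] at ha hb
      rw [abs_le]; constructor <;> linarith) z hz) hδ1')
  obtain ⟨i2, v2⟩ := hg2 (ψ (Set.Iic 0)) (hψi _ measurableSet_Iic) (fun z hz =>
    lt_of_lt_of_le (hdist _ (-1) (by
      intro s hs ha hb
      have hs' : s ≤ 0 := hs
      rw [abs_of_nonpos hs'] at ha hb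
      rw [abs_le]; constructor <;> linarith) z hz) hδ2')
  have h0 := divergence_zero H hp i0 Φ hΦ 2 hΦs
  have hsplit : ∀ x, (fderiv ℝ Φ (hmap H x) (Pi.single i0 1)) * jac H x =
      ψ (Set.Ioi 0) (hmap H x) * jac H x + ψ (Set.Iic 0) (hmap H x) * jac H x := by
    intro x
    rw [hder, hψ, hψ, ← add_mul, ← mul_add]
    congr 2
    by_cases hx : 0 < hmap H x i0
    · rw [Set.indicator_of_mem (by exact hx), Set.indicator_of_notMem (by simpa using hx), add_zero]
    · rw [Set.indicator_of_notMem (by exact hx), Set.indicator_of_mem (by simpa using hx), zero_add]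
  simp_rw [hsplit] at h0
  rw [integral_add i1 i2, v1, v2, hψv _ measurableSet_Ioi, hψv _ measurableSet_Iic, hI1, hI2] at h0
  have : c * (∑ x ∈ h1.toFinset, Real.sign (jac H x) - ∑ x ∈ h2.toFinset, Real.sign (jac H x)) = 0 := by
    linarith
  rcases mul_eq_zero.mp this with h | h
  · exact absurd h hc
  · linarith

end TreeInv

namespace TreeInv

/-! ### Part 4 : families of polynomials -/

section families
variable {α : Type*} [Fintype α] [DecidableEq α]
variable {R : Type*} [CommRing R]

noncomputable def polyA (k : α → ℕ) (c : (Σ i, Fin (k i)) → R) (i : α) : R[X] :=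
  X ^ (k i) + ∑ j : Fin (k i), C (c ⟨i, j⟩) * X ^ (j : ℕ)

noncomputable def fU (mu : α → ℕ) (A : α → R[X]) : R[X] := ∏ i, A i ^ mu i
noncomputable def fa (mu : α → ℕ) (A : α → R[X]) : R[X] := ∏ i, A i ^ (mu i - 1)
noncomputable def fP (mu : α → ℕ) (A B : α → R[X]) : R[X] :=
  ∑ i, C (mu i : R) * B i * ∏ j ∈ Finset.univ.erase i, A j

theorem polyA_low (k : α → ℕ) (c : (Σ i, Fin (k i)) → R) (i : α) :
    (∑ j : Fin (k i), C (c ⟨i, j⟩) * X ^ (j : ℕ)).degree < ((k i : ℕ) : WithBot ℕ) :=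
  degree_sum_fin_lt _

theorem polyA_monic (k : α → ℕ) (c : (Σ i, Fin (k i)) → R) (i : α) : (polyA k c i).Monic :=
  monic_X_pow_add (polyA_low k c i)

theorem polyA_natDegree [Nontrivial R] (k : α → ℕ) (c : (Σ i, Fin (k i)) → R) (i : α) :
    (polyA k c i).natDegree = k i :=
  natDegree_eq_of_degree_eq_some (by
    unfold polyA
    rw [degree_add_eq_left_of_degree_lt, degree_X_pow]
    rw [degree_X_pow]; exact polyA_low k c i)

theorem polyA_coeff (k : α → ℕ) (c : (Σ i, Fin (k i)) → R) (i : α) (j : Fin (k i)) :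
    (polyA k c i).coeff j = c ⟨i, j⟩ := by
  unfold polyA
  rw [coeff_add, coeff_X_pow, if_neg j.2.ne, zero_add, finsetSum_coeff]
  simp only [coeff_C_mul, coeff_X_pow]
  simp [Fin.val_inj]

theorem polyA_map {S : Type*} [CommRing S] (φ : R →+* S) (k : α → ℕ)
    (c : (Σ i, Fin (k i)) → R) (i : α) :
    (polyA k c i).map φ = polyA k (fun p => φ (c p)) i := by
  simp [polyA, Polynomial.map_sum]

theorem polyA_of_monic [Nontrivial R] (k : α → ℕ) (A : α → R[X]) (hA : ∀ i, (A i).Monic)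
    (hd : ∀ i, (A i).natDegree = k i) : polyA k (fun p => (A p.1).coeff p.2) = A := by
  funext i
  ext m
  rcases lt_trichotomy m (k i) with h | h | h
  · exact polyA_coeff k (fun p => (A p.1).coeff p.2) i ⟨m, h⟩
  · have h1 := (polyA_monic k (fun p => (A p.1).coeff p.2) i).coeff_natDegree
    have h2 := (hA i).coeff_natDegree
    rw [polyA_natDegree] at h1
    rw [hd] at h2
    rw [h, h1, h2]
  · rw [coeff_eq_zero_of_natDegree_lt, coeff_eq_zero_of_natDegree_lt]
    · rw [hd]; exact h
    · rw [polyA_natDegree]; exact h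

theorem fU_map {S : Type*} [CommRing S] (φ : R →+* S) (mu : α → ℕ) (A : α → R[X]) :
    (fU mu A).map φ = fU mu (fun i => (A i).map φ) := by
  simp [fU, Polynomial.map_prod]

theorem fa_map {S : Type*} [CommRing S] (φ : R →+* S) (mu : α → ℕ) (A : α → R[X]) :
    (fa mu A).map φ = fa mu (fun i => (A i).map φ) := by
  simp [fa, Polynomial.map_prod]

theorem fP_map {S : Type*} [CommRing S] (φ : R →+* S) (mu : α → ℕ) (A B : α → R[X]) :
    (fP mu A B).map φ = fP mu (fun i => (A i).map φ) (fun i => (B i).map φ) := by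
  simp [fP, Polynomial.map_prod, Polynomial.map_sum]

theorem fU_monic (mu : α → ℕ) (A : α → R[X]) (hA : ∀ i, (A i).Monic) : (fU mu A).Monic :=
  monic_prod_of_monic _ _ fun i _ => (hA i).pow _

theorem fa_monic (mu : α → ℕ) (A : α → R[X]) (hA : ∀ i, (A i).Monic) : (fa mu A).Monic :=
  monic_prod_of_monic _ _ fun i _ => (hA i).pow _

theorem fU_natDegree [Nontrivial R] (mu : α → ℕ) (A : α → R[X]) (hA : ∀ i, (A i).Monic) :
    (fU mu A).natDegree = ∑ i, mu i * (A i).natDegree := by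
  unfold fU
  rw [natDegree_prod_of_monic _ _ fun i _ => (hA i).pow _]
  exact Finset.sum_congr rfl fun i _ => (hA i).natDegree_pow _

theorem fa_natDegree [Nontrivial R] (mu : α → ℕ) (A : α → R[X]) (hA : ∀ i, (A i).Monic) :
    (fa mu A).natDegree = ∑ i, (mu i - 1) * (A i).natDegree := by
  unfold fa
  rw [natDegree_prod_of_monic _ _ fun i _ => (hA i).pow _]
  exact Finset.sum_congr rfl fun i _ => (hA i).natDegree_pow _

theorem fU_eq (mu : α → ℕ) (hmu : ∀ i, 0 < mu i) (A : α → R[X]) :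
    fU mu A = fa mu A * ∏ i, A i := by
  unfold fU fa
  rw [← Finset.prod_mul_distrib]
  refine Finset.prod_congr rfl fun i _ => ?_
  rw [← pow_succ, Nat.sub_add_cancel (hmu i)]

/-- degree bound for `fP` -/
theorem fP_natDegree_le [Nontrivial R] (mu : α → ℕ) (A B : α → R[X]) (hA : ∀ i, (A i).Monic)
    (K : ℕ) (hK : ∑ i, (A i).natDegree = K + 1)
    (hB : ∀ i, (B i).degree < (A i).natDegree) : (fP mu A B).natDegree ≤ K := by
  unfold fP
  apply natDegree_sum_le_of_forall_le
  intro i _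
  by_cases hb : B i = 0
  · simp [hb]
  have h0 : (B i).natDegree < (A i).natDegree := by
    have := hB i
    rwa [degree_eq_natDegree hb, Nat.cast_lt] at this
  have h1 : (∏ j ∈ Finset.univ.erase i, A j).natDegree
      = ∑ j ∈ Finset.univ.erase i, (A j).natDegree :=
    natDegree_prod_of_monic _ _ fun i _ => hA i
  have h2 := Finset.add_sum_erase Finset.univ (fun j => (A j).natDegree) (Finset.mem_univ i)
  have h3 := natDegree_mul_le (p := C (mu i : R) * B i) (q := ∏ j ∈ Finset.univ.erase i, A j)
  have h4 := natDegree_C_mul_le (mu i : R) (B i)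
  omega

theorem D_fU (D : Derivation ℤ R[X] R[X]) (mu : α → ℕ) (hmu : ∀ i, 0 < mu i) (A : α → R[X]) :
    D (fU mu A) = fa mu A * fP mu A (fun i => D (A i)) := by
  unfold fU fP
  rw [derivation_prod, Finset.mul_sum]
  refine Finset.sum_congr rfl fun i _ => ?_
  have h1 : fa mu A = A i ^ (mu i - 1) * ∏ j ∈ Finset.univ.erase i, A j ^ (mu j - 1) :=
    (Finset.mul_prod_erase Finset.univ (fun j => A j ^ (mu j - 1)) (Finset.mem_univ i)).symm
  have h2 : ∏ j ∈ Finset.univ.erase i, A j ^ mu j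
      = (∏ j ∈ Finset.univ.erase i, A j ^ (mu j - 1)) * ∏ j ∈ Finset.univ.erase i, A j := by
    rw [← Finset.prod_mul_distrib]
    refine Finset.prod_congr rfl fun i _ => ?_
    rw [← pow_succ, Nat.sub_add_cancel (hmu i)]
  rw [Derivation.leibniz_pow, h1, h2]
  simp only [smul_eq_mul, nsmul_eq_mul, map_natCast]
  ring

noncomputable def derivZ (R : Type*) [CommRing R] : Derivation ℤ R[X] R[X] :=
  (Polynomial.derivative' (R := R)).restrictScalars ℤ

theorem derivative_fU (mu : α → ℕ) (hmu : ∀ i, 0 < mu i) (A : α → R[X]) :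
    derivative (fU mu A) = fa mu A * fP mu A (fun i => derivative (A i)) :=
  D_fU (derivZ R) mu hmu A

/-- coefficientwise derivation -/
noncomputable def cwFun (d : Derivation ℤ R R) (p : R[X]) : R[X] :=
  ∑ m ∈ p.support, monomial m (d (p.coeff m))

theorem cwFun_coeff (d : Derivation ℤ R R) (p : R[X]) (m : ℕ) :
    (cwFun d p).coeff m = d (p.coeff m) := by
  unfold cwFun
  rw [finsetSum_coeff]
  simp only [coeff_monomial]
  rw [Finset.sum_ite_eq']
  split_ifs with h
  · rfl
  · rw [notMem_support_iff.1 h, map_zero]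

noncomputable def cw (d : Derivation ℤ R R) : Derivation ℤ R[X] R[X] where
  toFun := cwFun d
  map_add' p q := by ext m; simp [cwFun_coeff]
  map_smul' z p := by ext m; simp [cwFun_coeff]
  map_one_eq_zero' := by
    ext m
    change (cwFun d 1).coeff m = _
    rw [cwFun_coeff, coeff_one]
    split_ifs <;> simp
  leibniz' p q := by
    ext m
    change (cwFun d (p * q)).coeff m = (p * cwFun d q + q * cwFun d p).coeff m
    rw [mul_comm q, cwFun_coeff, coeff_add, coeff_mul, coeff_mul, coeff_mul, map_sum,
      ← Finset.sum_add_distrib]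
    refine Finset.sum_congr rfl fun x _ => ?_
    rw [d.leibniz, cwFun_coeff, cwFun_coeff]
    simp only [smul_eq_mul]
    ring

theorem cw_coeff (d : Derivation ℤ R R) (p : R[X]) (m : ℕ) :
    (cw d p).coeff m = d (p.coeff m) := cwFun_coeff d p m

theorem cw_derivative (d : Derivation ℤ R R) (p : R[X]) :
    cw d (derivative p) = derivative (cw d p) := by
  ext m
  rw [cw_coeff, coeff_derivative, coeff_derivative, cw_coeff, d.leibniz]
  have : d ((m : R) + 1) = 0 := by
    rw [map_add, d.map_natCast, d.map_one_eq_zero, add_zero]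
  rw [this]; simp [mul_comm]

end families

end TreeInv

namespace TreeInv

/-! ### Part 5 : linear algebra -/

abbrev KK (k l : ℕ) := Fin k ⊕ Fin l
abbrev OM (k l : ℕ) := (KK k l ⊕ Unit) ⊕ Unit

theorem coeff_mul_fin (a p : ℝ[X]) (m r : ℕ) (hp : p.degree < (m : ℕ)) :
    (a * p).coeff r = ∑ c : Fin m, (a * X ^ (c : ℕ)).coeff r * p.coeff c := by
  have h : p = ∑ c ∈ Finset.range m, C (p.coeff c) * X ^ c := by
    ext r
    rw [finsetSum_coeff]
    simp only [coeff_C_mul, coeff_X_pow, mul_ite, mul_one, mul_zero]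
    rw [Finset.sum_ite_eq]
    split_ifs with h
    · rfl
    · apply coeff_eq_zero_of_degree_lt (lt_of_lt_of_le hp _)
      rw [Finset.mem_range, not_lt] at h
      exact_mod_cast h
  conv_lhs => rw [h]
  rw [Finset.mul_sum, finsetSum_coeff, Finset.sum_range]
  refine Finset.sum_congr rfl fun c _ => ?_
  rw [mul_left_comm, coeff_C_mul, mul_comm]

noncomputable def Tm (k l : ℕ) (a b : ℝ[X]) : Matrix (KK k l) (KK k l) ℝ :=
  fun r s => Sum.elim (fun c : Fin k => (a * X ^ (c : ℕ)).coeff (finSumFinEquiv r : Fin (k + l)))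
    (fun c : Fin l => - (b * X ^ (c : ℕ)).coeff (finSumFinEquiv r : Fin (k + l))) s

theorem Tm_det_ne (k l : ℕ) (a b : ℝ[X]) (ha : a.Monic) (hb : b.Monic) (hda : a.natDegree = l)
    (hdb : b.natDegree = k) (hc : IsCoprime a b) : (Tm k l a b).det ≠ 0 := by
  intro h
  obtain ⟨v, hv, hv0⟩ := Matrix.exists_mulVec_eq_zero_iff.2 h
  apply hv
  set p : ℝ[X] := ∑ c : Fin k, C (v (Sum.inl c)) * X ^ (c : ℕ) with hp
  set q : ℝ[X] := ∑ c : Fin l, C (v (Sum.inr c)) * X ^ (c : ℕ) with hq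
  have hpd : p.degree < (k : ℕ) := degree_sum_fin_lt _
  have hqd : q.degree < (l : ℕ) := degree_sum_fin_lt _
  have hpc : ∀ c : Fin k, p.coeff c = v (Sum.inl c) := by
    intro c
    rw [hp, finsetSum_coeff]
    simp only [coeff_C_mul, coeff_X_pow]
    simp [Fin.val_inj]
  have hqc : ∀ c : Fin l, q.coeff c = v (Sum.inr c) := by
    intro c
    rw [hq, finsetSum_coeff]
    simp only [coeff_C_mul, coeff_X_pow]
    simp [Fin.val_inj]
  have hz : a * p - b * q = 0 := by
    have hdeg : (a * p - b * q).degree < ((k + l : ℕ) : WithBot ℕ) := by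
      refine lt_of_le_of_lt (degree_sub_le _ _) (max_lt ?_ ?_)
      · rw [degree_mul, degree_eq_natDegree ha.ne_zero, hda, add_comm, Nat.cast_add]
        exact WithBot.add_lt_add_right (by simp) hpd
      · rw [degree_mul, degree_eq_natDegree hb.ne_zero, hdb, Nat.cast_add]
        exact WithBot.add_lt_add_left (by simp) hqd
    ext r
    rw [coeff_zero]
    by_cases hr : r < k + l
    · have := congrFun hv0 (finSumFinEquiv.symm ⟨r, hr⟩)
      rw [Matrix.mulVec, dotProduct, Fintype.sum_sum_type] at this
      simp only [Tm, Sum.elim_inl, Sum.elim_inr, Equiv.apply_symm_apply, Pi.zero_apply] at this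
      rw [coeff_sub, coeff_mul_fin a p k r hpd, coeff_mul_fin b q l r hqd, ← this, sub_eq_add_neg,
        ← Finset.sum_neg_distrib]
      simp only [hpc, hqc, neg_mul]
    · exact coeff_eq_zero_of_degree_lt (lt_of_lt_of_le hdeg (by exact_mod_cast not_lt.1 hr))
  have h1 : a * p = b * q := sub_eq_zero.1 hz
  have hp0 : p = 0 := by
    have : b ∣ p := hc.symm.dvd_of_dvd_mul_left (Dvd.intro _ h1.symm)
    apply eq_zero_of_dvd_of_degree_lt this
    rwa [degree_eq_natDegree hb.ne_zero, hdb]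
  have hq0 : q = 0 := by
    have : a ∣ q := hc.dvd_of_dvd_mul_left (Dvd.intro _ h1)
    apply eq_zero_of_dvd_of_degree_lt this
    rwa [degree_eq_natDegree ha.ne_zero, hda]
  funext s
  rcases s with c | c
  · rw [← hpc, hp0]; rfl
  · rw [← hqc, hq0]; rfl

/-- the output vector -/
noncomputable def outV {R : Type*} [CommRing R] (k l : ℕ) (eA eB f u : R[X]) : OM k l → R :=
  Sum.elim (Sum.elim (Sum.elim (fun c : Fin k => eA.coeff c) (fun c : Fin l => eB.coeff c))
    (fun _ => f.coeff 0)) (fun _ => u.coeff (k + l))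

/-- the vector of coefficients of the cofactors -/
noncomputable def outL (k l : ℕ) (P Q : ℝ[X]) : OM k l → ℝ :=
  Sum.elim (Sum.elim (Sum.elim (fun c : Fin k => P.coeff c) (fun c : Fin l => Q.coeff c))
    (fun _ => Q.coeff l)) (fun _ => P.coeff k)

noncomputable def out1 (k l : ℕ) (f u : ℝ[X]) : OM k l → ℝ :=
  Sum.elim (Sum.elim (fun r => f.coeff (finSumFinEquiv r : Fin (k + l)))
    (fun _ => f.coeff (k + l))) (fun _ => u.coeff (k + l))

noncomputable def out2 (k l : ℕ) (f u : ℝ[X]) : OM k l → ℝ :=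
  Sum.elim (Sum.elim (fun r => (derivative f).coeff (finSumFinEquiv r : Fin (k + l)))
    (fun _ => f.coeff 0)) (fun _ => u.coeff (k + l))

noncomputable def sg (k l : ℕ) : Equiv.Perm (KK k l ⊕ Unit) :=
  ((Equiv.sumCongr finSumFinEquiv (Equiv.refl Unit)).trans
    ((Equiv.optionEquivSumPUnit (Fin (k + l))).symm.trans (finSuccEquiv (k + l)).symm)).trans
  (((Equiv.sumCongr finSumFinEquiv (Equiv.refl Unit)).trans
    ((Equiv.optionEquivSumPUnit (Fin (k + l))).symm.trans (finSuccEquivLast).symm)).symm)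

noncomputable def wt (k l : ℕ) : OM k l → ℝ :=
  Sum.elim (Sum.elim (fun r => (((finSumFinEquiv r : Fin (k + l)) : ℕ) : ℝ) + 1) (fun _ => 1))
    (fun _ => 1)

noncomputable def coefF (k l : ℕ) (f : ℝ[X]) : KK k l ⊕ Unit → ℝ := fun x =>
  f.coeff (((Equiv.sumCongr finSumFinEquiv (Equiv.refl Unit)).trans
    ((Equiv.optionEquivSumPUnit (Fin (k + l))).symm.trans (finSuccEquivLast).symm)) x :
    Fin (k + l + 1))

theorem out2_eq (k l : ℕ) (f u : ℝ[X]) (s : OM k l) :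
    out2 k l f u s = wt k l s * out1 k l f u (Equiv.sumCongr (sg k l) (Equiv.refl Unit) s) := by
  have h1 : ∀ x, out1 k l f u (Sum.inl x) = coefF k l f x := by
    intro x
    rcases x with x | x <;> simp [out1, coefF]
  rcases s with (x | x) | x
  · simp only [Equiv.sumCongr_apply, Sum.map_inl, h1]
    simp [out2, wt, coefF, sg, coeff_derivative, mul_comm]
  · simp only [Equiv.sumCongr_apply, Sum.map_inl, h1]
    simp [out2, wt, coefF, sg]
  · simp [out2, out1, wt]

theorem linalg (k l : ℕ) : ∃ C : ℝ, C ≠ 0 ∧ ∀ (a b : ℝ[X]), a.Monic → b.Monic →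
    a.natDegree = l → b.natDegree = k → IsCoprime a b →
    ∀ (eA eB P Q : OM k l → ℝ[X]), (∀ j, (eA j).degree < (k : ℕ)) → (∀ j, (eB j).degree < (l : ℕ)) →
    (∀ j, (P j).natDegree ≤ k) → (∀ j, (Q j).natDegree ≤ l) →
    (∀ j, derivative (a * P j - b * Q j) = a * eA j - b * eB j) →
    (Matrix.of fun i j => outV k l (eA j) (eB j) (a * P j - b * Q j) (a * P j) i).det
      = C * (Matrix.of fun i j => outL k l (P j) (Q j) i).det := by
  refine ⟨-((∏ s, wt k l s) * (Equiv.Perm.sign (Equiv.sumCongr (sg k l) (Equiv.refl Unit)) : ℤ)),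
    ?_, ?_⟩
  · apply neg_ne_zero.2
    apply mul_ne_zero
    · apply Finset.prod_ne_zero_iff.2
      rintro ((x | x) | x) _
      · simp only [wt, Sum.elim_inl]; positivity
      · simp [wt]
      · simp [wt]
    · rcases Int.units_eq_one_or (Equiv.Perm.sign (Equiv.sumCongr (sg k l) (Equiv.refl Unit)))
        with h | h <;> rw [h] <;> simp
  intro a b ha hb hda hdb hc eA eB P Q heA heB hP hQ hder
  have hT := Tm_det_ne k l a b ha hb hda hdb hc
  set M2 : Matrix (OM k l) (OM k l) ℝ :=
    Matrix.of fun i j => out2 k l (a * P j - b * Q j) (a * P j) i with hM2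
  set M1 : Matrix (OM k l) (OM k l) ℝ :=
    Matrix.of fun i j => out1 k l (a * P j - b * Q j) (a * P j) i with hM1
  set JJ : Matrix (OM k l) (OM k l) ℝ :=
    Matrix.of fun i j => outV k l (eA j) (eB j) (a * P j - b * Q j) (a * P j) i with hJJ
  set LL : Matrix (OM k l) (OM k l) ℝ := Matrix.of fun i j => outL k l (P j) (Q j) i with hLL
  have topP : ∀ j, (a * P j).coeff (k + l) = (P j).coeff k := by
    intro j
    rw [add_comm, coeff_mul_add_eq_of_natDegree_le hda.le (hP j), ← hda, ha.coeff_natDegree, one_mul]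
  have topQ : ∀ j, (b * Q j).coeff (k + l) = (Q j).coeff l := by
    intro j
    rw [coeff_mul_add_eq_of_natDegree_le hdb.le (hQ j), ← hdb, hb.coeff_natDegree, one_mul]
  have e1 : M2.det = (∏ s, wt k l s) *
      ((Equiv.Perm.sign (Equiv.sumCongr (sg k l) (Equiv.refl Unit)) : ℤ) * M1.det) := by
    rw [← Matrix.det_permute, ← Matrix.det_mul_column]
    congr 1
    ext i j
    simp only [hM2, Matrix.of_apply, out2_eq]
    rfl
  have e2 : (Matrix.fromBlocks (Matrix.fromBlocks (Tm k l a b) 0 0 (1 : Matrix Unit Unit ℝ)) 0 0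
      (1 : Matrix Unit Unit ℝ)) * JJ = M2 := by
    ext i j
    rw [Matrix.mul_apply, Fintype.sum_sum_type, Fintype.sum_sum_type, Fintype.sum_sum_type]
    rcases i with (x | x) | x
    · simp only [hM2, out2, Matrix.of_apply, Sum.elim_inl, hder]
      simp [hJJ, outV, Tm]
      rw [coeff_mul_fin a (eA j) k _ (heA j), coeff_mul_fin b (eB j) l _ (heB j), sub_eq_add_neg]
    · simp [hJJ, hM2, outV, out2]
    · simp [hJJ, hM2, outV, out2]
  have e3 : (Matrix.fromBlocks (Matrix.fromBlocks (Tm k l a b)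
        (Matrix.of fun r _ => - (b * X ^ l).coeff (finSumFinEquiv r : Fin (k + l)))
        0 (-1 : Matrix Unit Unit ℝ))
      (Matrix.of fun r _ => Sum.elim (fun r => (a * X ^ k).coeff (finSumFinEquiv r : Fin (k + l)))
        (fun _ => 1) r) 0
      (1 : Matrix Unit Unit ℝ)) * LL = M1 := by
    ext i j
    rw [Matrix.mul_apply, Fintype.sum_sum_type, Fintype.sum_sum_type, Fintype.sum_sum_type]
    rcases i with (x | x) | x
    · have hPd : (P j).degree < ((k + 1 : ℕ) : WithBot ℕ) :=
        lt_of_le_of_lt (degree_le_of_natDegree_le (hP j)) (by exact_mod_cast Nat.lt_succ_self k)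
      have hQd : (Q j).degree < ((l + 1 : ℕ) : WithBot ℕ) :=
        lt_of_le_of_lt (degree_le_of_natDegree_le (hQ j)) (by exact_mod_cast Nat.lt_succ_self l)
      simp only [hM1, out1, Matrix.of_apply, Sum.elim_inl]
      rw [coeff_sub, coeff_mul_fin a (P j) (k + 1) _ hPd, coeff_mul_fin b (Q j) (l + 1) _ hQd,
        Fin.sum_univ_castSucc, Fin.sum_univ_castSucc]
      simp [hLL, outL, Tm]
      ring
    · simp [hLL, hM1, outL, out1, topP, topQ]
      ring
    · simp [hLL, hM1, outL, out1, topP]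
  have d2 : (Tm k l a b).det * JJ.det = M2.det := by
    rw [← e2, Matrix.det_mul, Matrix.det_fromBlocks_zero₂₁, Matrix.det_fromBlocks_zero₂₁]
    simp
  have d3 : -(Tm k l a b).det * LL.det = M1.det := by
    rw [← e3, Matrix.det_mul, Matrix.det_fromBlocks_zero₂₁, Matrix.det_fromBlocks_zero₂₁]
    simp
  apply mul_left_cancel₀ hT
  rw [d2, e1, ← d3]
  ring

end TreeInv

namespace TreeInv

/-! ### Part 6 : Vandermonde computation -/

section vdm
variable {α : Type*} [Fintype α] [LinearOrder α]

theorem det_W {k : α → ℕ} (z : (Σ i, Fin (k i)) → ℂ) :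
    (Matrix.of fun p q : (Σ i, Fin (k i)) => if p.1 = q.1 then z p ^ (q.2 : ℕ) else 0).det
      = ∏ i, ∏ x : Fin (k i), ∏ y : Fin (k i), if x < y then z ⟨i, y⟩ - z ⟨i, x⟩ else 1 := by
  have hB : Matrix.BlockTriangular (Matrix.of fun p q : (Σ i, Fin (k i)) =>
      if p.1 = q.1 then z p ^ (q.2 : ℕ) else 0) Sigma.fst := by
    intro p q h
    simp [h.ne']
  rw [hB.det_fintype]
  refine Finset.prod_congr rfl fun i _ => ?_
  have h1 : (∏ x : Fin (k i), ∏ y : Fin (k i), if x < y then z ⟨i, y⟩ - z ⟨i, x⟩ else 1)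
      = (Matrix.vandermonde fun x : Fin (k i) => z ⟨i, x⟩).det := by
    rw [Matrix.det_vandermonde]
    refine Finset.prod_congr rfl fun x _ => ?_
    rw [← Finset.prod_filter]
    refine Finset.prod_congr ?_ fun _ _ => rfl
    ext y; simp
  rw [h1, ← Matrix.det_submatrix_equiv_self (Equiv.sigmaSubtype i).symm]
  congr 1
  ext x y
  simp [Matrix.toSquareBlock, Matrix.toSquareBlockProp, Matrix.vandermonde_apply, Equiv.sigmaSubtype]

theorem prod_split {k : α → ℕ} (z : (Σ i, Fin (k i)) → ℂ) {N : ℕ} (e : (Σ i, Fin (k i)) ≃ Fin N)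
    (he1 : ∀ p q, p.1 < q.1 → e p < e q) (he2 : ∀ i (x y : Fin (k i)), e ⟨i, x⟩ < e ⟨i, y⟩ ↔ x < y) :
    (∏ p, ∏ q, if e p < e q then z q - z p else 1)
      = (∏ p : (Σ i, Fin (k i)), ∏ q : (Σ i, Fin (k i)), if p.1 < q.1 then z q - z p else 1) *
      ∏ i, ∏ x : Fin (k i), ∏ y : Fin (k i), if x < y then z ⟨i, y⟩ - z ⟨i, x⟩ else 1 := by
  have h2 : (∏ i, ∏ x : Fin (k i), ∏ y : Fin (k i), if x < y then z ⟨i, y⟩ - z ⟨i, x⟩ else 1)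
      = ∏ p : (Σ i, Fin (k i)), ∏ q : (Σ i, Fin (k i)),
        if p.1 = q.1 ∧ e p < e q then z q - z p else 1 := by
    rw [Fintype.prod_sigma]
    refine Finset.prod_congr rfl fun i _ => Finset.prod_congr rfl fun x _ => ?_
    rw [Fintype.prod_sigma, Finset.prod_eq_single i]
    · refine Finset.prod_congr rfl fun y _ => ?_
      simp only [he2, true_and]
    · intro b _ hb
      refine Finset.prod_eq_one fun y _ => ?_
      rw [if_neg]
      rintro ⟨h, _⟩
      exact hb h.symm
    · simp
  rw [h2, ← Finset.prod_mul_distrib]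
  refine Finset.prod_congr rfl fun p _ => ?_
  rw [← Finset.prod_mul_distrib]
  refine Finset.prod_congr rfl fun q _ => ?_
  rcases lt_trichotomy p.1 q.1 with h | h | h
  · simp [h, he1 p q h, h.ne]
  · simp [h]
  · have := he1 q p h
    simp [h.not_gt, h.ne', this.not_gt]

theorem detL {k mu : α → ℕ} (z : (Σ i, Fin (k i)) → ℂ) (hz : Function.Injective z) {N : ℕ}
    (e : (Σ i, Fin (k i)) ≃ Fin N)
    (he1 : ∀ p q, p.1 < q.1 → e p < e q) (he2 : ∀ i (x y : Fin (k i)), e ⟨i, x⟩ < e ⟨i, y⟩ ↔ x < y)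
    (A : α → ℂ[X]) (hA : ∀ i, A i = ∏ j : Fin (k i), (X - C (z ⟨i, j⟩)))
    (L : Matrix (Σ i, Fin (k i)) (Σ i, Fin (k i)) ℂ)
    (Pq : (Σ i, Fin (k i)) → ℂ[X])
    (hPq : ∀ q, Pq q = C (mu q.1 : ℂ) * X ^ (q.2 : ℕ) * ∏ i ∈ Finset.univ.erase q.1, A i)
    (hPd : ∀ q, (Pq q).natDegree < N)
    (hL : ∀ p q, L p q = (Pq q).coeff (e p)) :
    L.det = (∏ p : (Σ i, Fin (k i)), (mu p.1 : ℂ)) *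
      (∏ p : (Σ i, Fin (k i)), ∏ q : (Σ i, Fin (k i)), if p.1 < q.1 then (-1 : ℂ) else 1) *
      ∏ p : (Σ i, Fin (k i)), ∏ q : (Σ i, Fin (k i)), if p.1 < q.1 then z q - z p else 1 := by
  set V : Matrix (Σ i, Fin (k i)) (Σ i, Fin (k i)) ℂ := Matrix.of fun p r => z p ^ (e r : ℕ) with hV
  set W : Matrix (Σ i, Fin (k i)) (Σ i, Fin (k i)) ℂ :=
    Matrix.of fun p q : (Σ i, Fin (k i)) => if p.1 = q.1 then z p ^ (q.2 : ℕ) else 0 with hW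
  have hAr : ∀ p : (Σ i, Fin (k i)), (A p.1).eval (z p) = 0 := by
    intro p
    rw [hA, eval_prod]
    exact Finset.prod_eq_zero (Finset.mem_univ p.2) (by simp)
  have hVL : V * L = Matrix.of fun p q => ((mu p.1 : ℂ) *
      ∏ i ∈ Finset.univ.erase p.1, (A i).eval (z p)) * W p q := by
    ext p q
    have h1 : (V * L) p q = (Pq q).eval (z p) := by
      rw [Matrix.mul_apply, eval_eq_sum_range' (hPd q), Finset.sum_range, ← e.sum_comp]
      refine Finset.sum_congr rfl fun r _ => ?_
      rw [hL, hV, Matrix.of_apply, mul_comm]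
    rw [h1, hPq, Matrix.of_apply, hW, Matrix.of_apply]
    simp only [eval_mul, eval_C, eval_pow, eval_X, eval_prod]
    by_cases h : p.1 = q.1
    · rw [if_pos h, h]; ring
    · rw [if_neg h, mul_zero, Finset.prod_eq_zero (i := p.1), mul_zero]
      · simp [h]
      · exact hAr p
  have hdV : V.det = ∏ p, ∏ q, if e p < e q then z q - z p else 1 := by
    have : V = (Matrix.vandermonde fun i => z (e.symm i)).submatrix e e := by
      ext p q; simp [hV, Matrix.vandermonde_apply]
    rw [this, Matrix.det_submatrix_equiv_self, Matrix.det_vandermonde, ← e.prod_comp]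
    refine Finset.prod_congr rfl fun p _ => ?_
    have h3 : Finset.Ioi (e p) = Finset.univ.filter (fun y => e p < y) := by ext y; simp
    rw [h3, Finset.prod_filter, ← e.prod_comp]
    simp
  have hG : V.det = (∏ p : (Σ i, Fin (k i)), ∏ q : (Σ i, Fin (k i)),
      if p.1 < q.1 then z q - z p else 1) * W.det := by
    rw [hdV, prod_split z e he1 he2, hW, det_W]
  have hVne : V.det ≠ 0 := by
    rw [hdV]
    refine Finset.prod_ne_zero_iff.2 fun p _ => Finset.prod_ne_zero_iff.2 fun q _ => ?_
    split_ifs with h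
    · rw [sub_ne_zero]
      intro h'
      rw [hz h'] at h
      exact lt_irrefl _ h
    · exact one_ne_zero
  have hev : ∀ p : (Σ i, Fin (k i)), ∏ i ∈ Finset.univ.erase p.1, (A i).eval (z p)
      = ∏ q : (Σ i, Fin (k i)), if p.1 = q.1 then 1 else z p - z q := by
    intro p
    rw [Fintype.prod_sigma, ← Finset.mul_prod_erase Finset.univ _ (Finset.mem_univ p.1)]
    simp only [if_true, Finset.prod_const_one, one_mul]
    refine Finset.prod_congr rfl fun i hi => ?_
    rw [hA, eval_prod]
    refine Finset.prod_congr rfl fun j _ => ?_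
    rw [if_neg (by simpa using (Finset.ne_of_mem_erase hi).symm)]
    simp
  have hprod : (∏ p : (Σ i, Fin (k i)), ∏ i ∈ Finset.univ.erase p.1, (A i).eval (z p))
      = (∏ p : (Σ i, Fin (k i)), ∏ q : (Σ i, Fin (k i)), if p.1 < q.1 then (-1 : ℂ) else 1) *
      (∏ p : (Σ i, Fin (k i)), ∏ q : (Σ i, Fin (k i)), if p.1 < q.1 then z q - z p else 1) *
      ∏ p : (Σ i, Fin (k i)), ∏ q : (Σ i, Fin (k i)), if p.1 < q.1 then z q - z p else 1 := by
    simp only [hev]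
    have hsplit : ∀ f g : (Σ i, Fin (k i)) → (Σ i, Fin (k i)) → ℂ,
        (∏ p, ∏ q, f p q) * ∏ p, ∏ q, g p q = ∏ p, ∏ q, f p q * g p q := by
      intro f g
      rw [← Finset.prod_mul_distrib]
      exact Finset.prod_congr rfl fun _ _ => Finset.prod_mul_distrib.symm
    have hcomm : (∏ p : (Σ i, Fin (k i)), ∏ q : (Σ i, Fin (k i)), if p.1 < q.1 then z q - z p else 1)
      = ∏ p : (Σ i, Fin (k i)), ∏ q : (Σ i, Fin (k i)), if q.1 < p.1 then z p - z q else 1 :=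
      Finset.prod_comm
    conv_rhs => arg 2; rw [hcomm]
    rw [hsplit, hsplit]
    refine Finset.prod_congr rfl fun p _ => Finset.prod_congr rfl fun q _ => ?_
    rcases lt_trichotomy p.1 q.1 with h | h | h
    · simp [h, h.ne, h.not_gt]
    · simp [h]
    · simp [h, h.ne', h.not_gt]
  have := congrArg Matrix.det hVL
  rw [Matrix.det_mul, Matrix.det_mul_column, hG, Finset.prod_mul_distrib, hprod] at this
  rw [hG] at hVne
  apply mul_left_cancel₀ hVne
  rw [this]
  ring

end vdm
end TreeInv

namespace TreeInv

/-! ### Part 7 : the polynomial map and its Jacobian -/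

structure Dat (α β : Type) [Fintype α] [Fintype β] where
  kA : α → ℕ
  muA : α → ℕ
  kB : β → ℕ
  muB : β → ℕ
  k : ℕ
  l : ℕ
  hmA : ∀ i, 0 < muA i
  hmB : ∀ i, 0 < muB i
  hkA : ∑ i, kA i = k + 1
  hkB : ∑ i, kB i = l + 1
  hA : ∑ i, muA i * kA i = k + l + 1
  hB : ∑ i, muB i * kB i = k + l + 1

section dat
variable {α β : Type} [Fintype α] [Fintype β] [LinearOrder α] [LinearOrder β]

abbrev Dat.JA (D : Dat α β) := Σ i : α, Fin (D.kA i)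
abbrev Dat.JB (D : Dat α β) := Σ i : β, Fin (D.kB i)
abbrev Dat.II (D : Dat α β) := D.JA ⊕ D.JB

variable (D : Dat α β) {R : Type*} [CommRing R]

noncomputable def Dat.A (c : D.II → R) : α → R[X] := polyA D.kA (fun p => c (Sum.inl p))
noncomputable def Dat.B (c : D.II → R) : β → R[X] := polyA D.kB (fun p => c (Sum.inr p))
noncomputable def Dat.U (c : D.II → R) : R[X] := fU D.muA (D.A c)
noncomputable def Dat.V (c : D.II → R) : R[X] := fU D.muB (D.B c)
noncomputable def Dat.a (c : D.II → R) : R[X] := fa D.muA (D.A c)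
noncomputable def Dat.b (c : D.II → R) : R[X] := fa D.muB (D.B c)
noncomputable def Dat.NA (c : D.II → R) : R[X] := fP D.muA (D.A c) (fun i => derivative (D.A c i))
noncomputable def Dat.NB (c : D.II → R) : R[X] := fP D.muB (D.B c) (fun i => derivative (D.B c i))
noncomputable def Dat.EA (c : D.II → R) : R[X] := D.NA c - C ((D.k + D.l + 1 : ℕ) : R) * D.b c
noncomputable def Dat.EB (c : D.II → R) : R[X] := D.NB c - C ((D.k + D.l + 1 : ℕ) : R) * D.a c
noncomputable def Dat.out (c : D.II → R) : OM D.k D.l → R :=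
  outV D.k D.l (D.EA c) (D.EB c) (D.U c - D.V c) (D.U c)

section nat
variable {S : Type*} [CommRing S] (φ : R →+* S) (c : D.II → R)

theorem Dat.A_map : (fun i => (D.A c i).map φ) = D.A (fun p => φ (c p)) := by
  funext i; exact polyA_map φ _ _ i
theorem Dat.B_map : (fun i => (D.B c i).map φ) = D.B (fun p => φ (c p)) := by
  funext i; exact polyA_map φ _ _ i
theorem Dat.U_map : (D.U c).map φ = D.U (fun p => φ (c p)) := by
  rw [Dat.U, fU_map, Dat.A_map]; rfl
theorem Dat.V_map : (D.V c).map φ = D.V (fun p => φ (c p)) := by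
  rw [Dat.V, fU_map, Dat.B_map]; rfl
theorem Dat.a_map : (D.a c).map φ = D.a (fun p => φ (c p)) := by
  rw [Dat.a, fa_map, Dat.A_map]; rfl
theorem Dat.b_map : (D.b c).map φ = D.b (fun p => φ (c p)) := by
  rw [Dat.b, fa_map, Dat.B_map]; rfl
theorem Dat.NA_map : (D.NA c).map φ = D.NA (fun p => φ (c p)) := by
  rw [Dat.NA, fP_map, Dat.A_map]
  simp only [← derivative_map]
  have := D.A_map φ c
  simp only [funext_iff] at this
  simp only [this]; rfl
theorem Dat.NB_map : (D.NB c).map φ = D.NB (fun p => φ (c p)) := by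
  rw [Dat.NB, fP_map, Dat.B_map]
  simp only [← derivative_map]
  have := D.B_map φ c
  simp only [funext_iff] at this
  simp only [this]; rfl
theorem Dat.EA_map : (D.EA c).map φ = D.EA (fun p => φ (c p)) := by
  rw [Dat.EA, Polynomial.map_sub, Polynomial.map_mul, Dat.NA_map, Dat.b_map]; simp [Dat.EA]
theorem Dat.EB_map : (D.EB c).map φ = D.EB (fun p => φ (c p)) := by
  rw [Dat.EB, Polynomial.map_sub, Polynomial.map_mul, Dat.NB_map, Dat.a_map]; simp [Dat.EB]
theorem outV_map (k l : ℕ) (p q r s : R[X]) (i : OM k l) :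
    φ (outV k l p q r s i) = outV k l (p.map φ) (q.map φ) (r.map φ) (s.map φ) i := by
  rcases i with ((i | i) | i) | i <;> simp [outV]
theorem Dat.out_map (s) : φ (D.out c s) = D.out (fun p => φ (c p)) s := by
  rw [Dat.out, outV_map, Dat.EA_map, Dat.EB_map, Polynomial.map_sub, Dat.U_map, Dat.V_map]; rfl
end nat

section basic
variable (c : D.II → R)
theorem Dat.A_monic (i) : (D.A c i).Monic := polyA_monic _ _ i
theorem Dat.B_monic (i) : (D.B c i).Monic := polyA_monic _ _ i
theorem Dat.U_monic : (D.U c).Monic := fU_monic _ _ (D.A_monic c)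
theorem Dat.V_monic : (D.V c).Monic := fU_monic _ _ (D.B_monic c)
theorem Dat.a_monic : (D.a c).Monic := fa_monic _ _ (D.A_monic c)
theorem Dat.b_monic : (D.b c).Monic := fa_monic _ _ (D.B_monic c)
theorem Dat.U_der : derivative (D.U c) = D.a c * D.NA c := derivative_fU _ D.hmA _
theorem Dat.V_der : derivative (D.V c) = D.b c * D.NB c := derivative_fU _ D.hmB _

theorem Dat.UV_der : derivative (D.U c - D.V c) = D.a c * D.EA c - D.b c * D.EB c := by
  rw [derivative_sub, Dat.U_der, Dat.V_der, Dat.EA, Dat.EB]; ring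

variable [Nontrivial R]
theorem Dat.A_deg (i) : (D.A c i).natDegree = D.kA i := polyA_natDegree _ _ i
theorem Dat.B_deg (i) : (D.B c i).natDegree = D.kB i := polyA_natDegree _ _ i
theorem Dat.U_deg : (D.U c).natDegree = D.k + D.l + 1 := by
  rw [Dat.U, fU_natDegree _ _ (D.A_monic c), ← D.hA]; simp only [Dat.A_deg]
theorem Dat.V_deg : (D.V c).natDegree = D.k + D.l + 1 := by
  rw [Dat.V, fU_natDegree _ _ (D.B_monic c), ← D.hB]; simp only [Dat.B_deg]

theorem sum_pred {γ : Type*} [Fintype γ] (mu kk : γ → ℕ) (hm : ∀ i, 0 < mu i) :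
    ∑ i, (mu i - 1) * kk i + ∑ i, kk i = ∑ i, mu i * kk i := by
  rw [← Finset.sum_add_distrib]
  refine Finset.sum_congr rfl fun i _ => ?_
  obtain ⟨m, hm⟩ : ∃ m, mu i = m + 1 := ⟨mu i - 1, by have := hm i; omega⟩
  rw [hm]; simp [add_mul]

theorem Dat.a_deg : (D.a c).natDegree = D.l := by
  rw [Dat.a, fa_natDegree _ _ (D.A_monic c)]; simp only [Dat.A_deg]
  have := sum_pred D.muA D.kA D.hmA
  have h1 := D.hkA
  have h2 := D.hA
  omega
theorem Dat.b_deg : (D.b c).natDegree = D.k := by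
  rw [Dat.b, fa_natDegree _ _ (D.B_monic c)]; simp only [Dat.B_deg]
  have := sum_pred D.muB D.kB D.hmB
  have h1 := D.hkB
  have h2 := D.hB
  omega

theorem der_deg_lt (p : R[X]) (hp : p.Monic) : (derivative p).degree < p.natDegree := by
  rw [← degree_eq_natDegree hp.ne_zero]
  exact degree_derivative_lt hp.ne_zero

theorem fPA_deg (Z : α → R[X]) (hZ : ∀ i, (Z i).degree < D.kA i) :
    (fP D.muA (D.A c) Z).natDegree ≤ D.k := by
  apply fP_natDegree_le _ _ _ (D.A_monic c)
  · simp only [Dat.A_deg, D.hkA]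
  · intro i; rw [D.A_deg]; exact hZ i
theorem fPB_deg (Z : β → R[X]) (hZ : ∀ i, (Z i).degree < D.kB i) :
    (fP D.muB (D.B c) Z).natDegree ≤ D.l := by
  apply fP_natDegree_le _ _ _ (D.B_monic c)
  · simp only [Dat.B_deg, D.hkB]
  · intro i; rw [D.B_deg]; exact hZ i

theorem Dat.NA_deg : (D.NA c).natDegree ≤ D.k :=
  fPA_deg D c _ fun i => by rw [← D.A_deg c i]; exact der_deg_lt _ (D.A_monic c i)
theorem Dat.NB_deg : (D.NB c).natDegree ≤ D.l :=
  fPB_deg D c _ fun i => by rw [← D.B_deg c i]; exact der_deg_lt _ (D.B_monic c i)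

theorem top_coeff (U a N : R[X]) (k l : ℕ) (hU : U.Monic) (hUd : U.natDegree = k + l + 1)
    (ha : a.Monic) (had : a.natDegree = l) (hN : N.natDegree ≤ k) (h : derivative U = a * N) :
    N.coeff k = ((k + l + 1 : ℕ) : R) := by
  have h1 := congrArg (fun p => p.coeff (l + k)) h
  rw [coeff_mul_add_eq_of_natDegree_le had.le hN, coeff_derivative, ← had, ha.coeff_natDegree,
    one_mul, had, add_comm l k, ← hUd, hU.coeff_natDegree] at h1
  rw [← h1]; push_cast; ring

theorem sub_deg_lt (N b : R[X]) (k : ℕ) (r : R) (hN : N.natDegree ≤ k) (hr : N.coeff k = r)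
    (hb : b.Monic) (hbd : b.natDegree = k) : (N - C r * b).degree < (k : ℕ) := by
  rw [degree_lt_iff_coeff_zero]
  intro m hm
  rw [coeff_sub, coeff_C_mul]
  rcases hm.eq_or_lt with h | h
  · subst h
    conv_lhs => rw [← hbd, hb.coeff_natDegree, hbd, hr]
    ring
  · rw [coeff_eq_zero_of_natDegree_lt (lt_of_le_of_lt hN h),
      coeff_eq_zero_of_natDegree_lt (by omega : b.natDegree < m)]; ring

theorem Dat.EA_deg : (D.EA c).degree < (D.k : ℕ) :=
  sub_deg_lt _ _ _ _ (D.NA_deg c) (top_coeff _ _ _ _ _ (D.U_monic c) (D.U_deg c) (D.a_monic c)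
    (D.a_deg c) (D.NA_deg c) (D.U_der c)) (D.b_monic c) (D.b_deg c)
theorem Dat.EB_deg : (D.EB c).degree < (D.l : ℕ) :=
  sub_deg_lt _ _ _ _ (D.NB_deg c) (by
    rw [top_coeff _ _ _ D.l D.k (D.V_monic c) (by rw [D.V_deg c]; ring) (D.b_monic c)
      (D.b_deg c) (D.NB_deg c) (D.V_der c), add_comm D.l]) (D.a_monic c) (D.a_deg c)

/-- vanishing of the first coordinates means vanishing of `EA`, `EB` -/
theorem Dat.E_zero (h : ∀ s, D.out c (Sum.inl (Sum.inl s)) = 0) : D.EA c = 0 ∧ D.EB c = 0 := by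
  constructor
  · ext m
    by_cases hm : m < D.k
    · exact h (Sum.inl ⟨m, hm⟩)
    · exact coeff_eq_zero_of_degree_lt (lt_of_lt_of_le (D.EA_deg c) (by exact_mod_cast not_lt.1 hm))
  · ext m
    by_cases hm : m < D.l
    · exact h (Sum.inr ⟨m, hm⟩)
    · exact coeff_eq_zero_of_degree_lt (lt_of_lt_of_le (D.EB_deg c) (by exact_mod_cast not_lt.1 hm))
end basic

end dat
end TreeInv

namespace TreeInv

/-! ### Part 8 : Jacobian -/

def rho0 (k l : ℕ) : (Fin k ⊕ Unit) ⊕ (Fin l ⊕ Unit) ≃ OM k l where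
  toFun := Sum.elim (Sum.elim (fun c => Sum.inl (Sum.inl (Sum.inl c))) (fun _ => Sum.inr ()))
    (Sum.elim (fun c => Sum.inl (Sum.inl (Sum.inr c))) (fun _ => Sum.inl (Sum.inr ())))
  invFun := Sum.elim (Sum.elim (Sum.elim (fun c => Sum.inl (Sum.inl c)) (fun c => Sum.inr (Sum.inl c)))
    (fun _ => Sum.inr (Sum.inr ()))) (fun _ => Sum.inl (Sum.inr ()))
  left_inv := by rintro ((c | c) | (c | c)) <;> rfl
  right_inv := by rintro (((c | c) | c) | c) <;> rfl

def rho (k l : ℕ) : Fin (k + 1) ⊕ Fin (l + 1) ≃ OM k l :=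
  (Equiv.sumCongr (finSuccEquivLast.trans (Equiv.optionEquivSumPUnit _))
    (finSuccEquivLast.trans (Equiv.optionEquivSumPUnit _))).trans (rho0 k l)

theorem outL_rho_inl (k l : ℕ) (P Q : ℝ[X]) (c) : outL k l P Q (rho k l (Sum.inl c)) = P.coeff c := by
  induction c using Fin.lastCases <;> simp [rho, rho0, outL]

theorem outL_rho_inr (k l : ℕ) (P Q : ℝ[X]) (c) : outL k l P Q (rho k l (Sum.inr c)) = Q.coeff c := by
  induction c using Fin.lastCases <;> simp [rho, rho0, outL]

section dat
variable {α β : Type} [Fintype α] [Fintype β] [LinearOrder α] [LinearOrder β]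
variable (D : Dat α β)

def Dat.e (eA : D.JA ≃ Fin (D.k + 1)) (eB : D.JB ≃ Fin (D.l + 1)) : D.II ≃ OM D.k D.l :=
  (Equiv.sumCongr eA eB).trans (rho D.k D.l)

noncomputable def Dat.H (e : D.II ≃ OM D.k D.l) : D.II → MvPolynomial D.II ℝ :=
  fun i => D.out (fun p => MvPolynomial.X p) (e i)

theorem Dat.hmap_H (e : D.II ≃ OM D.k D.l) (x : D.II → ℝ) (i : D.II) :
    hmap (D.H e) x i = D.out x (e i) := by
  unfold hmap Dat.H
  rw [D.out_map (MvPolynomial.eval x)]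
  simp

noncomputable def LA (x : D.II → ℝ) (q : D.JA) : ℝ[X] :=
  C (D.muA q.1 : ℝ) * X ^ (q.2 : ℕ) * ∏ i ∈ Finset.univ.erase q.1, D.A x i
noncomputable def LB (x : D.II → ℝ) (q : D.JB) : ℝ[X] :=
  C (D.muB q.1 : ℝ) * X ^ (q.2 : ℕ) * ∏ i ∈ Finset.univ.erase q.1, D.B x i

theorem cw_polyA {R : Type*} [CommRing R] {γ : Type*} [Fintype γ] [DecidableEq γ]
    (d : Derivation ℤ R R) (k : γ → ℕ) (c : (Σ i, Fin (k i)) → R) (i : γ) :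
    cw d (polyA k c i) = ∑ j : Fin (k i), C (d (c ⟨i, j⟩)) * X ^ (j : ℕ) := by
  ext m
  rw [cw_coeff, polyA, coeff_add, map_add, finsetSum_coeff, finsetSum_coeff, map_sum]
  have : d ((X ^ k i : R[X]).coeff m) = 0 := by
    rw [coeff_X_pow]; split_ifs <;> simp
  rw [this, zero_add]
  refine Finset.sum_congr rfl fun j _ => ?_
  rw [coeff_C_mul, coeff_C_mul, coeff_X_pow]
  split_ifs <;> simp

theorem fP_single {γ : Type*} [Fintype γ] [DecidableEq γ] (mu : γ → ℕ) (A B : γ → ℝ[X]) (i : γ)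
    (h : ∀ j, j ≠ i → B j = 0) :
    fP mu A B = C (mu i : ℝ) * B i * ∏ j ∈ Finset.univ.erase i, A j := by
  unfold fP
  rw [Finset.sum_eq_single i]
  · intro j _ hj; rw [h j hj]; simp
  · simp

theorem fP_zero {γ : Type*} [Fintype γ] [DecidableEq γ] (mu : γ → ℕ) (A B : γ → ℝ[X])
    (h : ∀ j, B j = 0) : fP mu A B = 0 := by
  unfold fP
  simp [h]

/-- restriction of scalars of a derivation -/
noncomputable def zD {S R : Type*} [CommRing S] [CommRing R] [Algebra S R] (d : Derivation S R R) :
    Derivation ℤ R R := d.restrictScalars ℤ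

theorem zD_apply {S R : Type*} [CommRing S] [CommRing R] [Algebra S R] (d : Derivation S R R) (r : R) :
    zD d r = d r := rfl

theorem cw_deg {R : Type*} [CommRing R] (d : Derivation ℤ R R) (p : R[X]) (k : ℕ)
    (h : p.degree < (k : ℕ)) : (cw d p).degree < (k : ℕ) := by
  rw [degree_lt_iff_coeff_zero] at *
  intro m hm
  rw [cw_coeff, h m hm, map_zero]

theorem cw_outV {R : Type*} [CommRing R] (d : Derivation ℤ R R) (k l : ℕ) (p q r s : R[X])
    (i : OM k l) :
    d (outV k l p q r s i) = outV k l (cw d p) (cw d q) (cw d r) (cw d s) i := by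
  rcases i with ((i | i) | i) | i <;> simp only [outV, Sum.elim_inl, Sum.elim_inr, cw_coeff]

theorem jac_eq0 (D : Dat α β) (eA : D.JA ≃ Fin (D.k + 1)) (eB : D.JB ≃ Fin (D.l + 1)) :
    ∃ C0 : ℝ, C0 ≠ 0 ∧ ∀ (K : Type) [CommRing K] [Nontrivial K] (φ : K →+* ℝ) (g : D.II → K)
      (dd : D.II → Derivation ℤ K K) (_ : ∀ q p, φ (dd q (g p)) = if p = q then 1 else 0)
      (x : D.II → ℝ) (_ : (fun p => φ (g p)) = x),
      D.EA x = 0 → D.EB x = 0 → IsCoprime (D.a x) (D.b x) →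
      (Matrix.of fun i q : D.II => φ (dd q (D.out g (D.e eA eB i)))).det = C0 *
        ((Matrix.of fun p q : D.JA => (LA D x q).coeff (eA p)).det *
         (Matrix.of fun p q : D.JB => (LB D x q).coeff (eB p)).det) := by
  obtain ⟨C0, hC0, hlin⟩ := linalg D.k D.l
  refine ⟨C0, hC0, ?_⟩
  intro K _ _ φ g dd hdelta x hgx hEA hEB hcop
  set e := D.e eA eB with he
  have mA : (fun i => (D.A g i).map φ) = D.A x := by rw [D.A_map φ g, hgx]
  have mB : (fun i => (D.B g i).map φ) = D.B x := by rw [D.B_map φ g, hgx]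
  have ma : (D.a g).map φ = D.a x := by rw [D.a_map φ g, hgx]
  have mb : (D.b g).map φ = D.b x := by rw [D.b_map φ g, hgx]
  have mEA : (D.EA g).map φ = 0 := by rw [D.EA_map φ g, hgx, hEA]
  have mEB : (D.EB g).map φ = 0 := by rw [D.EB_map φ g, hgx, hEB]
  set dA : D.II → α → ℝ[X] := fun q i => (cw (dd q) (D.A g i)).map φ with hdA
  set dB : D.II → β → ℝ[X] := fun q i => (cw (dd q) (D.B g i)).map φ with hdB
  set P : D.II → ℝ[X] := fun q => fP D.muA (D.A x) (dA q) with hP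
  set Q : D.II → ℝ[X] := fun q => fP D.muB (D.B x) (dB q) with hQ
  have dU : ∀ q, (cw (dd q) (D.U g)).map φ = D.a x * P q := by
    intro q
    rw [Dat.U, D_fU _ _ D.hmA, Polynomial.map_mul, fP_map, mA]
    rw [← ma]; rfl
  have dV : ∀ q, (cw (dd q) (D.V g)).map φ = D.b x * Q q := by
    intro q
    rw [Dat.V, D_fU _ _ D.hmB, Polynomial.map_mul, fP_map, mB]
    rw [← mb]; rfl
  set eAf : D.II → ℝ[X] := fun q => (cw (dd q) (D.EA g)).map φ with heAf
  set eBf : D.II → ℝ[X] := fun q => (cw (dd q) (D.EB g)).map φ with heBf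
  have hJ : (Matrix.of fun i q : D.II => φ (dd q (D.out g (e i)))) = Matrix.of fun i q => outV D.k D.l (eAf q) (eBf q)
      (D.a x * P q - D.b x * Q q) (D.a x * P q) (e i) := by
    ext i q
    rw [Matrix.of_apply, Matrix.of_apply, Dat.out, cw_outV, outV_map,
      map_sub, Polynomial.map_sub]
    rw [dU, dV]
  have hdAeq : ∀ q i, dA q i = ∑ j : Fin (D.kA i), C (φ (dd q (g (Sum.inl ⟨i, j⟩)))) * X ^ (j : ℕ) := by
    intro q i
    simp only [hdA, Dat.A, cw_polyA, Polynomial.map_sum, Polynomial.map_mul, map_C,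
      Polynomial.map_pow, map_X]
  have hdBeq : ∀ q i, dB q i = ∑ j : Fin (D.kB i), C (φ (dd q (g (Sum.inr ⟨i, j⟩)))) * X ^ (j : ℕ) := by
    intro q i
    simp only [hdB, Dat.B, cw_polyA, Polynomial.map_sum, Polynomial.map_mul, map_C,
      Polynomial.map_pow, map_X]
  have hPd : ∀ q, (P q).natDegree ≤ D.k := fun q => fPA_deg D x _ fun i => by
    rw [hdAeq]; exact degree_sum_fin_lt _
  have hQd : ∀ q, (Q q).natDegree ≤ D.l := fun q => fPB_deg D x _ fun i => by
    rw [hdBeq]; exact degree_sum_fin_lt _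
  have hPl : ∀ q, P (Sum.inl q) = LA D x q := by
    rintro ⟨i, j⟩
    have h1 : ∀ i', i' ≠ i → dA (Sum.inl ⟨i, j⟩) i' = 0 := by
      intro i' hi
      rw [hdAeq]
      refine Finset.sum_eq_zero fun j' _ => ?_
      rw [hdelta, if_neg]
      · simp
      · intro h
        simp only [Sum.inl.injEq, Sigma.mk.injEq] at h
        exact hi h.1
    have h2 : dA (Sum.inl ⟨i, j⟩) i = X ^ (j : ℕ) := by
      rw [hdAeq, Finset.sum_eq_single j]
      · rw [hdelta, if_pos rfl]; simp
      · intro j' _ hj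
        rw [hdelta, if_neg]
        · simp
        · intro h
          simp only [Sum.inl.injEq, Sigma.mk.injEq, heq_eq_eq, true_and] at h
          exact hj h
      · simp
    simp only [hP]
    rw [fP_single _ _ _ i h1, h2]; rfl
  have hPr : ∀ q, P (Sum.inr q) = 0 := by
    intro q
    refine fP_zero _ _ _ fun i => ?_
    rw [hdAeq]
    refine Finset.sum_eq_zero fun j' _ => ?_
    rw [hdelta, if_neg (by simp)]; simp
  have hQr : ∀ q, Q (Sum.inr q) = LB D x q := by
    rintro ⟨i, j⟩
    have h1 : ∀ i', i' ≠ i → dB (Sum.inr ⟨i, j⟩) i' = 0 := by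
      intro i' hi
      rw [hdBeq]
      refine Finset.sum_eq_zero fun j' _ => ?_
      rw [hdelta, if_neg]
      · simp
      · intro h
        simp only [Sum.inr.injEq, Sigma.mk.injEq] at h
        exact hi h.1
    have h2 : dB (Sum.inr ⟨i, j⟩) i = X ^ (j : ℕ) := by
      rw [hdBeq, Finset.sum_eq_single j]
      · rw [hdelta, if_pos rfl]; simp
      · intro j' _ hj
        rw [hdelta, if_neg]
        · simp
        · intro h
          simp only [Sum.inr.injEq, Sigma.mk.injEq, heq_eq_eq, true_and] at h
          exact hj h
      · simp
    simp only [hQ]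
    rw [fP_single _ _ _ i h1, h2]; rfl
  have hQl : ∀ q, Q (Sum.inl q) = 0 := by
    intro q
    refine fP_zero _ _ _ fun i => ?_
    rw [hdBeq]
    refine Finset.sum_eq_zero fun j' _ => ?_
    rw [hdelta, if_neg (by simp)]; simp
  have hder : ∀ q, derivative (D.a x * P q - D.b x * Q q) = D.a x * eAf q - D.b x * eBf q := by
    intro q
    rw [← dU, ← dV, ← Polynomial.map_sub, ← map_sub, derivative_map, ← cw_derivative, D.UV_der g,
      map_sub, Derivation.leibniz, Derivation.leibniz]
    simp only [smul_eq_mul, Polynomial.map_sub, Polynomial.map_add, Polynomial.map_mul, mEA, mEB,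
      ma, mb, zero_mul, add_zero]
    rfl
  have key := hlin (D.a x) (D.b x) (D.a_monic x) (D.b_monic x) (D.a_deg x) (D.b_deg x) hcop
    (fun s => eAf (e.symm s)) (fun s => eBf (e.symm s)) (fun s => P (e.symm s))
    (fun s => Q (e.symm s))
    (fun s => lt_of_le_of_lt degree_map_le (cw_deg _ _ _ (D.EA_deg g)))
    (fun s => lt_of_le_of_lt degree_map_le (cw_deg _ _ _ (D.EB_deg g)))
    (fun s => hPd _) (fun s => hQd _) (fun s => hder _)
  rw [hJ, ← Matrix.det_fromBlocks_zero₂₁ _ (0 : Matrix D.JA D.JB ℝ)]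
  rw [← Matrix.det_submatrix_equiv_self e.symm]
  refine Eq.trans ?_ (key.trans ?_)
  · congr 1
    ext i j
    simp
  · congr 1
    rw [← Matrix.det_submatrix_equiv_self e]
    congr 1
    ext i j
    rw [Matrix.submatrix_apply, Matrix.of_apply]
    rcases i with i | i
    · have : e (Sum.inl i) = rho D.k D.l (Sum.inl (eA i)) := rfl
      rw [this, outL_rho_inl]
      rcases j with j | j
      · simp [hPl]
      · simp [hPr]
    · have : e (Sum.inr i) = rho D.k D.l (Sum.inr (eB i)) := rfl
      rw [this, outL_rho_inr]
      rcases j with j | j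
      · simp [hQl]
      · simp [hQr]

theorem jac_eq (D : Dat α β) (eA : D.JA ≃ Fin (D.k + 1)) (eB : D.JB ≃ Fin (D.l + 1)) :
    ∃ C0 : ℝ, C0 ≠ 0 ∧ ∀ x : D.II → ℝ, D.EA x = 0 → D.EB x = 0 → IsCoprime (D.a x) (D.b x) →
      jac (D.H (D.e eA eB)) x = C0 *
        ((Matrix.of fun p q : D.JA => (LA D x q).coeff (eA p)).det *
         (Matrix.of fun p q : D.JB => (LB D x q).coeff (eB p)).det) := by
  obtain ⟨C0, hC0, h⟩ := jac_eq0 D eA eB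
  refine ⟨C0, hC0, ?_⟩
  intro x hEA hEB hcop
  refine Eq.trans ?_ (h (MvPolynomial D.II ℝ) (MvPolynomial.eval x) (fun p => MvPolynomial.X p)
    (fun q => zD (MvPolynomial.pderiv q)) ?_ x ?_ hEA hEB hcop)
  · rfl
  · intro q p
    rw [zD_apply, MvPolynomial.pderiv_X, Pi.single_apply]
    split_ifs <;> simp
  · funext p; simp

end dat
end TreeInv

namespace TreeInv

/-! ### Part 9 : properness -/

theorem proper_of_homog {ι : Type*} [Fintype ι] (w v : ι → ℕ) (hw : ∀ p, 0 < w p)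
    (hv : ∀ i, 0 < v i) (F : (ι → ℝ) → (ι → ℝ)) (hF : Continuous F)
    (hom : ∀ s : ℝ, 0 < s → ∀ c i, F (fun p => s ^ (w p) * c p) i = s ^ (v i) * F c i)
    (h0 : ∀ c, F c = 0 → c = 0) (R : ℝ) : Bornology.IsBounded {x | ‖F x‖ ≤ R} := by
  set nu : (ι → ℝ) → ℝ := fun c => ∑ p, |c p| ^ ((w p : ℝ)⁻¹) with hnu
  have hnuc : Continuous nu := by
    refine continuous_finsetSum _ fun p _ => ?_
    exact ((continuous_apply p).abs).rpow_const fun x => Or.inr (by positivity)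
  have hle : ∀ c p, |c p| ≤ nu c ^ (w p) := by
    intro c p
    have h1 : |c p| ^ ((w p : ℝ)⁻¹) ≤ nu c :=
      Finset.single_le_sum (f := fun p => |c p| ^ ((w p : ℝ)⁻¹))
        (fun i _ => by positivity) (Finset.mem_univ p)
    calc |c p| = (|c p| ^ ((w p : ℝ)⁻¹)) ^ (w p) :=
          (Real.rpow_inv_natCast_pow (abs_nonneg _) (hw p).ne').symm
      _ ≤ _ := by gcongr
  have hscale : ∀ s : ℝ, 0 < s → ∀ c, nu (fun p => s ^ (w p) * c p) = s * nu c := by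
    intro s hs c
    simp only [hnu, Finset.mul_sum]
    refine Finset.sum_congr rfl fun p _ => ?_
    rw [abs_mul, Real.mul_rpow (abs_nonneg _) (abs_nonneg _), abs_of_pos (pow_pos hs _),
      Real.pow_rpow_inv_natCast hs.le (hw p).ne']
  set K : Set (ι → ℝ) := {c | nu c = 1} with hK
  have hKc : IsCompact K := by
    apply Metric.isCompact_of_isClosed_isBounded
    · exact isClosed_eq hnuc continuous_const
    · refine (Metric.isBounded_closedBall (x := (0 : ι → ℝ)) (r := 1)).subset fun c hc => ?_
      rw [mem_closedBall_zero_iff, pi_norm_le_iff_of_nonneg zero_le_one]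
      intro p
      have := hle c p
      rw [show nu c = 1 from hc, one_pow] at this
      exact this
  obtain ⟨δ, hδ, hδK⟩ : ∃ δ > 0, ∀ c ∈ K, δ ≤ ‖F c‖ := by
    rcases K.eq_empty_or_nonempty with h | h
    · exact ⟨1, one_pos, by simp [h]⟩
    · obtain ⟨c, hc, hmin⟩ := hKc.exists_isMinOn h hF.norm.continuousOn
      refine ⟨‖F c‖, ?_, fun c' hc' => hmin hc'⟩
      rw [gt_iff_lt, norm_pos_iff]
      intro hz
      have := h0 c hz
      rw [hK, Set.mem_ofPred_eq, this] at hc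
      have h2 : nu 0 = 0 := by
        simp only [hnu]
        refine Finset.sum_eq_zero fun p _ => ?_
        simp only [Pi.zero_apply, abs_zero]
        exact Real.zero_rpow (inv_ne_zero (by exact_mod_cast (hw p).ne'))
      rw [h2] at hc
      exact zero_ne_one hc
  have hbound : ∀ x, ‖F x‖ ≤ R → nu x ≤ max 1 (R / δ) := by
    intro x hx
    by_cases h1 : nu x ≤ 1
    · exact h1.trans (le_max_left _ _)
    push Not at h1
    apply le_max_of_le_right
    rw [le_div_iff₀ hδ]
    set s := nu x with hs
    have hs0 : 0 < s := by linarith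
    set c : ι → ℝ := fun p => (s⁻¹) ^ (w p) * x p with hc
    have hxc : x = fun p => s ^ (w p) * c p := by
      funext p
      simp only [hc]
      rw [← mul_assoc, ← mul_pow, mul_inv_cancel₀ hs0.ne', one_pow, one_mul]
    have hcK : c ∈ K := by
      rw [hK, Set.mem_ofPred_eq, hc, hscale _ (inv_pos.2 hs0), ← hs, inv_mul_cancel₀ hs0.ne']
    refine le_trans ?_ hx
    have h3 : ‖F c‖ ≤ ‖F x‖ / s := by
      rw [pi_norm_le_iff_of_nonneg (by positivity)]
      intro i
      rw [le_div_iff₀ hs0]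
      refine le_trans ?_ (norm_le_pi_norm (F x) i)
      conv_rhs => rw [hxc, hom s hs0]
      rw [norm_mul, mul_comm, norm_pow, Real.norm_of_nonneg hs0.le]
      gcongr
      exact le_self_pow₀ h1.le (hv i).ne'
    rw [le_div_iff₀ hs0] at h3
    calc s * δ ≤ s * ‖F c‖ := by gcongr; exact hδK c hcK
      _ ≤ _ := by linarith
  rw [isBounded_iff_forall_norm_le]
  set M := max 1 (R / δ) with hM
  refine ⟨∑ p, M ^ (w p), fun x hx => ?_⟩
  have hM1 : 1 ≤ M := le_max_left _ _
  rw [pi_norm_le_iff_of_nonneg (by positivity)]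
  intro p
  have h0 : 0 ≤ nu x := Finset.sum_nonneg fun p _ => by positivity
  calc ‖x p‖ ≤ nu x ^ (w p) := hle x p
    _ ≤ M ^ (w p) := by gcongr; exact hbound x hx
    _ ≤ _ := Finset.single_le_sum (f := fun p => M ^ (w p)) (fun i _ => by positivity)
        (Finset.mem_univ p)

/-- A complex polynomial all of whose critical points are roots -/
theorem pow_of_roots (U : ℂ[X]) (hU : U.Monic) (n : ℕ) (hn : U.natDegree = n + 1)
    (h : ∀ z, (derivative U).IsRoot z → U.IsRoot z) : ∃ z, U = (X - C z) ^ (n + 1) := by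
  have hd : (derivative U).natDegree = n := by
    rw [natDegree_derivative, hn]; rfl
  have hU0 := hU.ne_zero
  have hd0 : derivative U ≠ 0 := by
    intro h0
    have := derivative_eq_zero.1 h0
    omega
  have hr : U.roots = (derivative U).roots + U.roots.dedup := by
    ext z
    rw [Multiset.count_add, Multiset.count_dedup, count_roots, count_roots]
    by_cases hz : U.IsRoot z
    · rw [if_pos ((mem_roots hU0).2 hz), derivative_rootMultiplicity_of_root hz]
      have := (rootMultiplicity_pos hU0).2 hz
      omega
    · rw [if_neg (fun hh => hz ((mem_roots hU0).1 hh)), rootMultiplicity_eq_zero hz,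
        rootMultiplicity_eq_zero (fun hh => hz (h z hh))]
  have hc := congrArg Multiset.card hr
  rw [Multiset.card_add, (IsAlgClosed.splits U).natDegree_eq_card_roots.symm,
    (IsAlgClosed.splits (derivative U)).natDegree_eq_card_roots.symm, hd, hn] at hc
  have hc1 : Multiset.card U.roots.dedup = 1 := by omega
  obtain ⟨z, hz⟩ := Multiset.card_eq_one.1 hc1
  refine ⟨z, ?_⟩
  have hrep : U.roots = Multiset.replicate (n + 1) z := by
    rw [Multiset.eq_replicate]
    refine ⟨by rw [← (IsAlgClosed.splits U).natDegree_eq_card_roots, hn], fun b hb => ?_⟩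
    have : b ∈ U.roots.dedup := Multiset.mem_dedup.2 hb
    rwa [hz, Multiset.mem_singleton] at this
  have := (IsAlgClosed.splits U).eq_prod_roots_of_monic hU
  rw [this, hrep, Multiset.map_replicate, Multiset.prod_replicate]

theorem monic_dvd_X_pow (A : ℝ[X]) (hA : A.Monic) (n k : ℕ) (hk : A.natDegree = k) (h : A ∣ X ^ n) :
    A = X ^ k := by
  obtain ⟨m, _, hm⟩ := (dvd_prime_pow prime_X n).1 h
  have := eq_of_monic_of_associated hA (monic_X_pow m) hm
  rw [this] at hk ⊢
  rw [natDegree_X_pow] at hk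
  rw [hk]

section dat
variable {α β : Type} [Fintype α] [Fintype β] [LinearOrder α] [LinearOrder β]
variable (D : Dat α β)

theorem polyA_eq_zero {γ : Type*} [Fintype γ] [DecidableEq γ] (k mu : γ → ℕ)
    (hmu : ∀ i, 0 < mu i) (c : (Σ i, Fin (k i)) → ℝ)
    (n : ℕ) (h : fU mu (polyA k c) = X ^ n) : c = 0 := by
  funext ⟨i, j⟩
  rw [← polyA_coeff k c i j]
  have hd : polyA k c i ∣ X ^ n := by
    rw [← h]
    refine (dvd_pow_self _ (hmu i).ne').trans ?_
    exact Finset.dvd_prod_of_mem (fun i => polyA k c i ^ mu i) (Finset.mem_univ i)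
  rw [monic_dvd_X_pow _ (polyA_monic k c i) n _ (polyA_natDegree k c i) hd, coeff_X_pow,
    if_neg j.2.ne]
  rfl

theorem Dat.zero_fiber (c : D.II → ℝ) (h : D.out c = 0) : c = 0 := by
  obtain ⟨hEA, hEB⟩ := D.E_zero c (fun s => congrFun h _)
  have ht : (D.U c - D.V c).coeff 0 = 0 := congrFun h (Sum.inl (Sum.inr ()))
  have hcent : (D.U c).coeff (D.k + D.l) = 0 := congrFun h (Sum.inr ())
  have hUV : D.U c = D.V c := by
    rw [← sub_eq_zero]
    have hd : derivative (D.U c - D.V c) = 0 := by rw [D.UV_der, hEA, hEB]; simp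
    have := eq_C_of_derivative_eq_zero hd
    rw [this, ht, C_0]
  have hUd : derivative (D.U c) = C ((D.k + D.l + 1 : ℕ) : ℝ) * (D.a c * D.b c) := by
    rw [D.U_der]
    have : D.NA c = C ((D.k + D.l + 1 : ℕ) : ℝ) * D.b c := sub_eq_zero.1 hEA
    rw [this]; ring
  have haU : D.a c ∣ D.U c := ⟨_, fU_eq _ D.hmA _⟩
  have hbU : D.b c ∣ D.U c := by rw [hUV]; exact ⟨_, fU_eq _ D.hmB _⟩
  set Uc := (D.U c).map (algebraMap ℝ ℂ) with hUc
  obtain ⟨z, hz⟩ := pow_of_roots Uc ((D.U_monic c).map _) (D.k + D.l)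
    (by rw [hUc, natDegree_map, D.U_deg]) (by
      intro z hz
      rw [hUc, derivative_map, hUd, IsRoot.def, Polynomial.map_mul, Polynomial.map_mul, eval_mul,
        eval_mul, map_C, eval_C, mul_eq_zero, mul_eq_zero] at hz
      rcases hz with hz | hz | hz
      · exfalso
        rw [map_natCast] at hz
        exact Nat.cast_ne_zero.2 (Nat.succ_ne_zero _) hz
      · exact IsRoot.dvd (show IsRoot _ z from hz) (Polynomial.map_dvd _ haU)
      · exact IsRoot.dvd (show IsRoot _ z from hz) (Polynomial.map_dvd _ hbU))
  have hz0 : z = 0 := by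
    have h1 : Uc.coeff (D.k + D.l) = 0 := by rw [hUc, coeff_map, hcent, map_zero]
    rw [hz, sub_eq_add_neg, ← C_neg, coeff_X_add_C_pow] at h1
    simp only [add_tsub_cancel_left, pow_one, Nat.choose_succ_self_right, mul_eq_zero] at h1
    rcases h1 with h1 | h1
    · simpa using h1
    · exact absurd h1 (Nat.cast_ne_zero.2 (Nat.succ_ne_zero _))
  have hUX : D.U c = X ^ (D.k + D.l + 1) := by
    apply Polynomial.map_injective (algebraMap ℝ ℂ) (algebraMap ℝ ℂ).injective
    rw [← hUc, hz, hz0]; simp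
  have h1 := polyA_eq_zero _ _ D.hmA _ _ hUX
  rw [hUV] at hUX
  have h2 := polyA_eq_zero _ _ D.hmB _ _ hUX
  funext p
  rcases p with p | p
  · exact congrFun h1 p
  · exact congrFun h2 p

/-- weights of the coordinates -/
def Dat.w : D.II → ℕ := Sum.elim (fun p => D.kA p.1 - p.2) (fun p => D.kB p.1 - p.2)
def Dat.v : OM D.k D.l → ℕ := Sum.elim (Sum.elim (Sum.elim (fun c => D.k - c) (fun c => D.l - c))
  (fun _ => D.k + D.l + 1)) (fun _ => 1)

theorem sum_comp_fin {γ : Type*} (t : Finset γ) (f : γ → ℝ[X]) (q : ℝ[X]) :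
    (∑ i ∈ t, f i).comp q = ∑ i ∈ t, (f i).comp q :=
  map_sum (Polynomial.compRingHom q) f t

theorem polyA_scale {γ : Type*} [Fintype γ] [DecidableEq γ] (k : γ → ℕ) (c : (Σ i, Fin (k i)) → ℝ)
    (s : ℝ) (i : γ) :
    (polyA k (fun p => s ^ (k p.1 - (p.2 : ℕ)) * c p) i).comp (C s * X) = C (s ^ k i) * polyA k c i := by
  unfold polyA
  simp only [add_comp, X_pow_comp, mul_pow, mul_add, sum_comp_fin, mul_comp, C_comp,
    Finset.mul_sum, ← C_pow]
  congr 1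
  refine Finset.sum_congr rfl fun j _ => ?_
  have : s ^ k i = s ^ (k i - (j : ℕ)) * s ^ (j : ℕ) := by
    rw [← pow_add, Nat.sub_add_cancel j.2.le]
  rw [this]
  simp only [C_mul]
  ring

theorem der_comp_scale (p q : ℝ[X]) (s r : ℝ) (h : p.comp (C s * X) = C r * q) :
    C s * (derivative p).comp (C s * X) = C r * derivative q := by
  have := congrArg derivative h
  rw [derivative_comp, derivative_C_mul, derivative_C_mul, derivative_X, mul_one] at this
  rw [← this]

theorem coeff_comp_scale (p : ℝ[X]) (s : ℝ) (m : ℕ) :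
    (p.comp (C s * X)).coeff m = p.coeff m * s ^ m := by
  rw [comp_C_mul_X_coeff]

theorem fU_scale {γ : Type*} [Fintype γ] (mu k : γ → ℕ) (A A' : γ → ℝ[X]) (s : ℝ)
    (h : ∀ i, (A' i).comp (C s * X) = C (s ^ k i) * A i) :
    (fU mu A').comp (C s * X) = C (s ^ (∑ i, mu i * k i)) * fU mu A := by
  unfold fU
  rw [Polynomial.prod_comp]
  simp only [pow_comp, h, mul_pow, Finset.prod_mul_distrib, Finset.prod_pow_eq_pow_sum, ← C_pow,
    ← pow_mul]
  congr 1
  rw [← map_prod, Finset.prod_pow_eq_pow_sum]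
  simp only [mul_comm]

theorem fa_scale {γ : Type*} [Fintype γ] (mu k : γ → ℕ) (A A' : γ → ℝ[X]) (s : ℝ)
    (h : ∀ i, (A' i).comp (C s * X) = C (s ^ k i) * A i) :
    (fa mu A').comp (C s * X) = C (s ^ (∑ i, (mu i - 1) * k i)) * fa mu A := by
  have := fU_scale (fun i => mu i - 1) k A A' s h
  exact this

theorem fN_scale {γ : Type*} [Fintype γ] [DecidableEq γ] (mu k : γ → ℕ) (A A' : γ → ℝ[X]) (s : ℝ)
    (hs : s ≠ 0) (K : ℕ) (hK : ∑ i, k i = K + 1)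
    (h : ∀ i, (A' i).comp (C s * X) = C (s ^ k i) * A i) :
    (fP mu A' (fun i => derivative (A' i))).comp (C s * X)
      = C (s ^ K) * fP mu A (fun i => derivative (A i)) := by
  have hCs : (C s : ℝ[X]) ≠ 0 := C_ne_zero.2 hs
  apply mul_left_cancel₀ hCs
  rw [← mul_assoc, ← C_mul, ← pow_succ', ← hK]
  unfold fP
  rw [sum_comp_fin, Finset.mul_sum, Finset.mul_sum]
  refine Finset.sum_congr rfl fun i _ => ?_
  rw [mul_comp, mul_comp, C_comp, Polynomial.prod_comp]
  simp only [h, Finset.prod_mul_distrib, ← map_prod, Finset.prod_pow_eq_pow_sum]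
  have h2 := der_comp_scale _ _ _ _ (h i)
  have h3 : s ^ (∑ i, k i) = s ^ k i * s ^ (∑ j ∈ Finset.univ.erase i, k j) := by
    rw [← pow_add, Finset.add_sum_erase Finset.univ k (Finset.mem_univ i)]
  rw [h3, C_mul]
  linear_combination (C (mu i : ℝ) * C (s ^ (∑ j ∈ Finset.univ.erase i, k j)) *
    ∏ j ∈ Finset.univ.erase i, A j) * h2

theorem Dat.out_scale (s : ℝ) (hs : 0 < s) (c : D.II → ℝ) (i : OM D.k D.l) :
    D.out (fun p => s ^ (D.w p) * c p) i = s ^ (D.v i) * D.out c i := by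
  set c' : D.II → ℝ := fun p => s ^ (D.w p) * c p with hc'
  have hA : ∀ i, (D.A c' i).comp (C s * X) = C (s ^ D.kA i) * D.A c i := fun i =>
    polyA_scale D.kA (fun p => c (Sum.inl p)) s i
  have hB : ∀ i, (D.B c' i).comp (C s * X) = C (s ^ D.kB i) * D.B c i := fun i =>
    polyA_scale D.kB (fun p => c (Sum.inr p)) s i
  have sa : ∑ i, (D.muA i - 1) * D.kA i = D.l := by
    have := sum_pred D.muA D.kA D.hmA
    have h1 := D.hkA
    have h2 := D.hA
    omega
  have sb : ∑ i, (D.muB i - 1) * D.kB i = D.k := by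
    have := sum_pred D.muB D.kB D.hmB
    have h1 := D.hkB
    have h2 := D.hB
    omega
  have hU : (D.U c').comp (C s * X) = C (s ^ (D.k + D.l + 1)) * D.U c := by
    rw [← D.hA]; exact fU_scale _ _ _ _ s hA
  have hV : (D.V c').comp (C s * X) = C (s ^ (D.k + D.l + 1)) * D.V c := by
    rw [← D.hB]; exact fU_scale _ _ _ _ s hB
  have ha : (D.a c').comp (C s * X) = C (s ^ D.l) * D.a c := by
    rw [← sa]; exact fa_scale _ _ _ _ s hA
  have hb : (D.b c').comp (C s * X) = C (s ^ D.k) * D.b c := by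
    rw [← sb]; exact fa_scale _ _ _ _ s hB
  have hNA : (D.NA c').comp (C s * X) = C (s ^ D.k) * D.NA c :=
    fN_scale _ _ _ _ s hs.ne' _ D.hkA hA
  have hNB : (D.NB c').comp (C s * X) = C (s ^ D.l) * D.NB c :=
    fN_scale _ _ _ _ s hs.ne' _ D.hkB hB
  have hEA : (D.EA c').comp (C s * X) = C (s ^ D.k) * D.EA c := by
    rw [Dat.EA, sub_comp, mul_comp, C_comp, hNA, hb, Dat.EA]; ring
  have hEB : (D.EB c').comp (C s * X) = C (s ^ D.l) * D.EB c := by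
    rw [Dat.EB, sub_comp, mul_comp, C_comp, hNB, ha, Dat.EB]; ring
  have gen : ∀ (p q : ℝ[X]) (K m : ℕ), m ≤ K → p.comp (C s * X) = C (s ^ K) * q →
      p.coeff m = s ^ (K - m) * q.coeff m := by
    intro p q K m hm h
    have h1 := congrArg (fun f => f.coeff m) h
    simp only [coeff_comp_scale, coeff_C_mul] at h1
    have h2 : s ^ K = s ^ (K - m) * s ^ m := by rw [← pow_add, Nat.sub_add_cancel hm]
    apply mul_right_cancel₀ (pow_ne_zero m hs.ne')
    rw [h1, h2]; ring
  rcases i with ((i | i) | i) | i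
  · exact gen _ _ D.k i i.2.le hEA
  · exact gen _ _ D.l i i.2.le hEB
  · exact gen (D.U c' - D.V c') (D.U c - D.V c) (D.k + D.l + 1) 0 (Nat.zero_le _)
      (by rw [sub_comp, hU, hV]; ring)
  · have := gen _ _ (D.k + D.l + 1) (D.k + D.l) (by omega) hU
    rw [show D.k + D.l + 1 - (D.k + D.l) = 1 by omega] at this
    exact this

theorem Dat.proper (e : D.II ≃ OM D.k D.l) (R : ℝ) :
    Bornology.IsBounded {x | ‖hmap (D.H e) x‖ ≤ R} := by
  apply proper_of_homog D.w (fun i => D.v (e i))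
  · rintro (p | p)
    · exact Nat.sub_pos_of_lt p.2.2
    · exact Nat.sub_pos_of_lt p.2.2
  · intro i
    rcases e i with ((i | i) | i) | i
    · exact Nat.sub_pos_of_lt i.2
    · exact Nat.sub_pos_of_lt i.2
    · exact Nat.succ_pos _
    · exact Nat.succ_pos _
  · exact hmap_cont _
  · intro s hs c i
    rw [D.hmap_H, D.hmap_H]
    exact D.out_scale s hs c (e i)
  · intro c hc
    apply D.zero_fiber
    funext s
    have := congrFun hc (e.symm s)
    rw [D.hmap_H, Equiv.apply_symm_apply] at this
    exact this

end dat
end TreeInv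

namespace TreeInv

/-! ### Part 10 : ramification -/

section ram
variable {J : Type*} [Fintype J]

theorem roots_prodpow (z : J → ℂ) (m : J → ℕ) :
    (∏ p, (X - C (z p)) ^ m p).roots = ∑ p, m p • ({z p} : Multiset ℂ) := by
  have : ∀ s : Finset J, (∏ p ∈ s, (X - C (z p)) ^ m p).roots
      = ∑ p ∈ s, m p • ({z p} : Multiset ℂ) := by
    intro s
    induction s using Finset.induction_on with
    | empty => simp
    | insert a s ha ih =>
      rw [Finset.prod_insert ha, Finset.sum_insert ha, roots_mul, ih, roots_pow, roots_X_sub_C]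
      exact mul_ne_zero (pow_ne_zero _ (X_sub_C_ne_zero _))
        (Finset.prod_ne_zero_iff.2 fun p _ => pow_ne_zero _ (X_sub_C_ne_zero _))
  exact this _

theorem rm_prodpow (z : J → ℂ) (hz : Function.Injective z) (m : J → ℕ) (p : J) :
    (∏ p, (X - C (z p)) ^ m p).rootMultiplicity (z p) = m p := by
  rw [← count_roots, roots_prodpow, Multiset.count_sum', Finset.sum_eq_single p]
  · simp
  · intro q _ hq
    rw [Multiset.count_nsmul, Multiset.count_singleton, if_neg]
    · simp
    · intro h; exact hq (hz h).symm
  · simp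

theorem toFinset_prodpow (z : J → ℂ) (m : J → ℕ) (hm : ∀ p, 0 < m p) :
    (∏ p, (X - C (z p)) ^ m p).roots.toFinset = Finset.univ.image z := by
  ext w
  rw [roots_prodpow, Multiset.mem_toFinset, Multiset.mem_sum, Finset.mem_image]
  constructor
  · rintro ⟨p, hp, h⟩
    exact ⟨p, hp, (Multiset.mem_singleton.1 (Multiset.mem_of_mem_nsmul h)).symm⟩
  · rintro ⟨p, hp, rfl⟩
    exact ⟨p, hp, by rw [Multiset.mem_nsmul_of_ne_zero (hm p).ne']; simp⟩

theorem ramType_prodpow (P : ℝ[X]) (w : ℝ) (z : J → ℂ) (hz : Function.Injective z) (m : J → ℕ)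
    (hm : ∀ p, 0 < m p)
    (h : P.map (algebraMap ℝ ℂ) - C (w : ℂ) = ∏ p, (X - C (z p)) ^ m p) :
    ramType P w = (Finset.univ : Finset J).val.map m := by
  unfold ramType
  rw [h, toFinset_prodpow z m hm, Finset.image_val_of_injOn hz.injOn, Multiset.map_map]
  refine Multiset.map_congr rfl fun p _ => ?_
  exact rm_prodpow z hz m p

theorem ramType_sub (P : ℝ[X]) (w : ℝ) : ramType (P - C w) 0 = ramType P w := by
  unfold ramType
  have : (P - C w).map (algebraMap ℝ ℂ) - C ((0 : ℝ) : ℂ) = P.map (algebraMap ℝ ℂ) - C (w : ℂ) := by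
    simp
  rw [this]

theorem ramType_neg (P : ℝ[X]) (w : ℝ) : ramType (-P) (-w) = ramType P w := by
  unfold ramType
  have : (-P).map (algebraMap ℝ ℂ) - C ((-w : ℝ) : ℂ) = C (-1) * (P.map (algebraMap ℝ ℂ) - C (w : ℂ)) := by
    simp; ring
  rw [this, roots_C_mul _ (by simp)]
  refine Multiset.map_congr rfl fun p _ => ?_
  rw [← count_roots, ← count_roots, roots_C_mul _ (by simp)]
end ram

section fam
variable {α : Type*} [Fintype α] [DecidableEq α] {k : α → ℕ}

theorem enum_roots (A : α → ℝ[X]) (hA : ∀ i, (A i).Monic) (hd : ∀ i, (A i).natDegree = k i)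
    (hs : ∀ i, (A i).Separable) (hc : ∀ i j, i ≠ j → IsCoprime (A i) (A j)) :
    ∃ z : (Σ i, Fin (k i)) → ℂ, Function.Injective z ∧
      ∀ i, (A i).map (algebraMap ℝ ℂ) = ∏ j : Fin (k i), (X - C (z ⟨i, j⟩)) := by
  have hcard : ∀ i, ((A i).map (algebraMap ℝ ℂ)).roots.toFinset.card = k i := by
    intro i
    rw [Multiset.toFinset_card_of_nodup (nodup_roots ((hs i).map)),
      ← (IsAlgClosed.splits _).natDegree_eq_card_roots, natDegree_map, hd]
  set ee : ∀ i, Fin (k i) ≃ ((A i).map (algebraMap ℝ ℂ)).roots.toFinset := fun i =>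
    (Finset.equivFinOfCardEq (hcard i)).symm with hee
  refine ⟨fun p => (ee p.1 p.2 : ℂ), ?_, ?_⟩
  · rintro ⟨i, x⟩ ⟨j, y⟩ h
    simp only at h
    by_cases hij : i = j
    · subst hij
      rw [(ee i).injective (Subtype.ext h)]
    · exfalso
      have h1 := isRoot_of_mem_roots (Multiset.mem_toFinset.1 (ee i x).2)
      have h2 := isRoot_of_mem_roots (Multiset.mem_toFinset.1 (ee j y).2)
      rw [← h] at h2
      obtain ⟨u, v, huv⟩ := (hc i j hij).map (mapRingHom (algebraMap ℝ ℂ))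
      have := congrArg (eval (ee i x : ℂ)) huv
      simp only [coe_mapRingHom, eval_add, eval_mul, h1.eq_zero, h2.eq_zero, mul_zero, add_zero,
        eval_one] at this
      exact zero_ne_one this
  · intro i
    have h1 := (IsAlgClosed.splits ((A i).map (algebraMap ℝ ℂ))).eq_prod_roots_of_monic ((hA i).map _)
    have h2 : ((A i).map (algebraMap ℝ ℂ)).roots = ((A i).map (algebraMap ℝ ℂ)).roots.toFinset.val :=
      (Multiset.dedup_eq_self.2 (nodup_roots ((hs i).map))).symm
    rw [h2] at h1
    conv_lhs => rw [h1]
    change ∏ w ∈ ((A i).map (algebraMap ℝ ℂ)).roots.toFinset, (X - C w) = _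
    rw [← Finset.prod_coe_sort, ← (ee i).prod_comp]

theorem fU_prodpow (mu : α → ℕ) (A : α → ℝ[X]) (z : (Σ i, Fin (k i)) → ℂ)
    (h : ∀ i, (A i).map (algebraMap ℝ ℂ) = ∏ j : Fin (k i), (X - C (z ⟨i, j⟩))) :
    (fU mu A).map (algebraMap ℝ ℂ) = ∏ p : (Σ i, Fin (k i)), (X - C (z p)) ^ mu p.1 := by
  rw [fU_map, fU, Fintype.prod_sigma]
  refine Finset.prod_congr rfl fun i _ => ?_
  rw [h, ← Finset.prod_pow]

/-- the canonical factor with roots of multiplicity `m` -/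
noncomputable def Acan (P : ℂ[X]) (m : ℕ) : ℂ[X] :=
  ∏ w ∈ P.roots.toFinset.filter (fun w => P.rootMultiplicity w = m), (X - C w)

theorem Acan_eq (mu : α → ℕ) (hmu : Function.Injective mu) (hpos : ∀ i, 0 < mu i)
    (z : (Σ i, Fin (k i)) → ℂ) (hz : Function.Injective z) (i : α) :
    Acan (∏ p : (Σ i, Fin (k i)), (X - C (z p)) ^ mu p.1) (mu i)
      = ∏ j : Fin (k i), (X - C (z ⟨i, j⟩)) := by
  unfold Acan
  rw [toFinset_prodpow z _ (fun p => hpos p.1)]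
  symm
  refine Finset.prod_bij (fun j _ => z ⟨i, j⟩) ?_ ?_ ?_ ?_
  · intro j _
    simp only [Finset.mem_filter, Finset.mem_image, Finset.mem_univ, true_and]
    exact ⟨⟨_, rfl⟩, rm_prodpow z hz (fun p => mu p.1) ⟨i, j⟩⟩
  · intro x _ y _ h
    have := hz h
    simpa using this
  · intro w hw
    simp only [Finset.mem_filter, Finset.mem_image, Finset.mem_univ, true_and] at hw
    obtain ⟨⟨⟨i', j⟩, rfl⟩, h⟩ := hw
    rw [rm_prodpow z hz (fun p => mu p.1)] at h
    have := hmu h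
    subst this
    exact ⟨j, Finset.mem_univ _, rfl⟩
  · intro _ _; rfl

theorem conj_map_real (P : ℝ[X]) :
    (P.map (algebraMap ℝ ℂ)).map (starRingEnd ℂ) = P.map (algebraMap ℝ ℂ) := by
  ext m; simp

theorem rm_conj (P : ℝ[X]) (w : ℂ) :
    (P.map (algebraMap ℝ ℂ)).rootMultiplicity (starRingEnd ℂ w)
      = (P.map (algebraMap ℝ ℂ)).rootMultiplicity w := by
  have := eq_rootMultiplicity_map (p := P.map (algebraMap ℝ ℂ)) (f := starRingEnd ℂ)
    (starRingEnd ℂ).injective w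
  rw [this, conj_map_real]

theorem real_of_conj (Q : ℂ[X]) (h : Q.map (starRingEnd ℂ) = Q) :
    ∃ A : ℝ[X], A.map (algebraMap ℝ ℂ) = Q := by
  have : Q ∈ Polynomial.lifts (algebraMap ℝ ℂ) := by
    rw [Polynomial.lifts_iff_coeff_lifts]
    intro n
    have h1 := congrArg (fun f => f.coeff n) h
    simp only [coeff_map] at h1
    obtain ⟨r, hr⟩ := Complex.conj_eq_iff_real.1 h1
    exact ⟨r, hr.symm⟩
  exact (Polynomial.mem_lifts _).1 this

theorem Acan_real (P : ℝ[X]) (hP : P ≠ 0) (m : ℕ) :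
    ∃ A : ℝ[X], A.map (algebraMap ℝ ℂ) = Acan (P.map (algebraMap ℝ ℂ)) m := by
  apply real_of_conj
  have hP' : P.map (algebraMap ℝ ℂ) ≠ 0 := by
    rwa [Ne, Polynomial.map_eq_zero]
  have hmem : ∀ w, w ∈ (P.map (algebraMap ℝ ℂ)).roots.toFinset.filter
      (fun w => (P.map (algebraMap ℝ ℂ)).rootMultiplicity w = m) →
      starRingEnd ℂ w ∈ (P.map (algebraMap ℝ ℂ)).roots.toFinset.filter
      (fun w => (P.map (algebraMap ℝ ℂ)).rootMultiplicity w = m) := by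
    intro w hw
    simp only [Finset.mem_filter, Multiset.mem_toFinset, mem_roots hP', ← rootMultiplicity_pos hP',
      rm_conj] at hw ⊢
    exact hw
  unfold Acan
  rw [Polynomial.map_prod]
  refine Finset.prod_bij (fun w _ => starRingEnd ℂ w) (fun w hw => hmem w hw) ?_ ?_ ?_
  · intro x _ y _ h; exact (starRingEnd ℂ).injective h
  · intro w hw
    exact ⟨starRingEnd ℂ w, hmem w hw, by simp⟩
  · intro w _; simp

theorem exists_family (mu : α → ℕ) (hmu : Function.Injective mu) (P : ℝ[X])
    (hP : P.Monic) (hr : ramType P 0 = (Finset.univ : Finset (Σ i, Fin (k i))).val.map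
      (fun p => mu p.1)) :
    ∃ A : α → ℝ[X], (∀ i, (A i).Monic) ∧ (∀ i, (A i).natDegree = k i) ∧ P = fU mu A := by
  set Pc := P.map (algebraMap ℝ ℂ) with hPc
  have hPcm : Pc.Monic := hP.map _
  choose A hA using fun i => Acan_real P hP.ne_zero (mu i)
  have hr' : Pc.roots.toFinset.val.map (fun w => Pc.rootMultiplicity w)
      = (Finset.univ : Finset (Σ i, Fin (k i))).val.map (fun p => mu p.1) := by
    rw [← hr]; unfold ramType; simp [hPc]
  have hmon : ∀ i, (A i).Monic := by
    intro i
    apply monic_of_injective (algebraMap ℝ ℂ).injective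
    rw [hA]
    exact monic_prod_of_monic _ _ fun w _ => monic_X_sub_C w
  refine ⟨A, hmon, ?_, ?_⟩
  · intro i
    rw [← natDegree_map (algebraMap ℝ ℂ), hA, Acan, natDegree_prod_of_monic _ _
      fun w _ => monic_X_sub_C w]
    simp only [natDegree_X_sub_C, Finset.sum_const, smul_eq_mul, mul_one]
    have h1 := congrArg (Multiset.count (mu i)) hr'
    rw [Multiset.count_map, Multiset.count_map] at h1
    have h2 : (Finset.univ.filter (fun p : (Σ i, Fin (k i)) => mu i = mu p.1)).card = k i := by
      have : (Finset.univ.filter (fun p : (Σ i, Fin (k i)) => mu i = mu p.1))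
          = Finset.univ.map (Function.Embedding.sigmaMk (β := fun i => Fin (k i)) i) := by
        ext ⟨i', j⟩
        simp only [Finset.mem_filter, Finset.mem_univ, true_and, Finset.mem_map,
          Function.Embedding.sigmaMk_apply]
        constructor
        · intro h
          have := hmu h
          subst this
          exact ⟨j, rfl⟩
        · rintro ⟨a, ha⟩
          rw [Sigma.mk.injEq] at ha
          rw [ha.1]
      rw [this]; simp
    refine Eq.trans ?_ (h1.trans h2)
    rw [← Finset.filter_val]
    change _ = (Finset.filter _ _).card
    congr 1
    ext w
    simp [hPc, eq_comm]
  · apply Polynomial.map_injective (algebraMap ℝ ℂ) (algebraMap ℝ ℂ).injective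
    rw [fU_map, ← hPc, fU]
    simp only [hA, ← hPc]
    have h1 : Pc = ∏ w ∈ Pc.roots.toFinset, (X - C w) ^ Pc.rootMultiplicity w := by
      conv_lhs => rw [(IsAlgClosed.splits Pc).eq_prod_roots_of_monic hPcm]
      rw [Finset.prod_multiset_map_count]
      simp only [count_roots]
    have h2 : ∀ i, Acan Pc (mu i) ^ mu i = ∏ w ∈ Pc.roots.toFinset.filter
        (fun w => Pc.rootMultiplicity w = mu i), (X - C w) ^ Pc.rootMultiplicity w := by
      intro i
      rw [Acan, ← Finset.prod_pow]
      refine Finset.prod_congr rfl fun w hw => ?_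
      rw [(Finset.mem_filter.1 hw).2]
    simp only [h2]
    conv_lhs => rw [h1]
    have h3 : ∀ w ∈ Pc.roots.toFinset, ∃ i, Pc.rootMultiplicity w = mu i := by
      intro w hw
      have : Pc.rootMultiplicity w ∈ Pc.roots.toFinset.val.map (fun w => Pc.rootMultiplicity w) :=
        Multiset.mem_map_of_mem _ hw
      rw [hr', Multiset.mem_map] at this
      obtain ⟨p, _, hp⟩ := this
      exact ⟨p.1, hp.symm⟩
    simp only [Finset.prod_filter]
    rw [Finset.prod_comm]
    refine Finset.prod_congr rfl fun w hw => ?_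
    obtain ⟨i, hi⟩ := h3 w hw
    rw [Finset.prod_eq_single i]
    · rw [if_pos hi]
    · intro i' _ hne
      rw [if_neg]
      intro h
      exact hne (hmu (h.symm.trans hi))
    · simp
end fam

end TreeInv

namespace TreeInv

/-! ### Part 11 : fibre analysis -/

section sepcop
variable {α : Type*} [Fintype α] [DecidableEq α]

theorem sep_cop (mu : α → ℕ) (A : α → ℝ[X])
    (h : ∀ i, IsCoprime (A i) (fP mu A (fun i => derivative (A i)))) :
    (∀ i, (A i).Separable) ∧ ∀ i j, i ≠ j → IsCoprime (A i) (A j) := by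
  have key : ∀ i, IsCoprime (A i)
      (C (mu i : ℝ) * derivative (A i) * ∏ j ∈ Finset.univ.erase i, A j) := by
    intro i
    have h1 := h i
    unfold fP at h1
    rw [← Finset.add_sum_erase _ _ (Finset.mem_univ i)] at h1
    have h2 : A i ∣ ∑ x ∈ Finset.univ.erase i,
        C (mu x : ℝ) * derivative (A x) * ∏ j ∈ Finset.univ.erase x, A j := by
      refine Finset.dvd_sum fun x hx => Dvd.dvd.mul_left ?_ _
      exact Finset.dvd_prod_of_mem _ (Finset.mem_erase.2 ⟨(Finset.ne_of_mem_erase hx).symm,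
        Finset.mem_univ i⟩)
    obtain ⟨S, hS⟩ := h2
    rw [hS] at h1
    exact IsCoprime.of_add_mul_left_right h1
  constructor
  · intro i
    exact (key i).of_mul_right_left.of_mul_right_right
  · intro i j hij
    refine (key i).of_mul_right_right.of_isCoprime_of_dvd_right ?_
    exact Finset.dvd_prod_of_mem _ (Finset.mem_erase.2 ⟨hij.symm, Finset.mem_univ j⟩)
end sepcop

section fib
variable {α β : Type} [Fintype α] [Fintype β] [LinearOrder α] [LinearOrder β]
variable (D : Dat α β)

/-- the fibre over `t` -/
structure Fib (x : D.II → ℝ) (t : ℝ) : Prop where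
  ea : D.EA x = 0
  eb : D.EB x = 0
  uv : D.U x = D.V x + C t
  u0 : (D.U x).coeff (D.k + D.l) = 0

theorem fib_iff (x : D.II → ℝ) (t : ℝ) : Fib D x t ↔
    ((∀ s, D.out x (Sum.inl (Sum.inl s)) = 0) ∧ D.out x (Sum.inl (Sum.inr ())) = t ∧
      D.out x (Sum.inr ()) = 0) := by
  constructor
  · intro h
    refine ⟨?_, ?_, h.u0⟩
    · rintro (s | s)
      · change (D.EA x).coeff s = 0
        rw [h.ea, coeff_zero]
      · change (D.EB x).coeff s = 0
        rw [h.eb, coeff_zero]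
    · change (D.U x - D.V x).coeff 0 = t
      rw [h.uv]; simp
  · rintro ⟨h1, h2, h3⟩
    obtain ⟨ea, eb⟩ := D.E_zero x h1
    refine ⟨ea, eb, ?_, h3⟩
    have h4 := D.UV_der x
    rw [ea, eb, mul_zero, mul_zero, sub_zero] at h4
    have h5 := derivative_eq_zero.1 h4
    have h6 := eq_C_of_natDegree_eq_zero h5
    have h7 : (D.U x - D.V x).coeff 0 = t := h2
    rw [h7] at h6
    rw [← h6]; ring

variable {D} {x : D.II → ℝ} {t : ℝ}

theorem dvd_of_fa {γ : Type*} [Fintype γ] [DecidableEq γ] (mu : γ → ℕ) (hmu : ∀ i, 0 < mu i) (A : γ → ℝ[X]) :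
    fa mu A ∣ fU mu A := ⟨_, fU_eq mu hmu A⟩

theorem dvd_of_A {γ : Type*} [Fintype γ] [DecidableEq γ] (mu : γ → ℕ) (hmu : ∀ i, 0 < mu i) (A : γ → ℝ[X]) (i : γ) :
    A i ∣ fU mu A :=
  (dvd_pow_self _ (hmu i).ne').trans (Finset.dvd_prod_of_mem (fun i => A i ^ mu i) (Finset.mem_univ i))

theorem cop_UV (ht : t ≠ 0) (h : D.U x = D.V x + C t) : IsCoprime (D.U x) (D.V x) := by
  refine ⟨C t⁻¹, - C t⁻¹, ?_⟩
  rw [h]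
  have : C t⁻¹ * C t = (1 : ℝ[X]) := by rw [← C_mul, inv_mul_cancel₀ ht, C_1]
  linear_combination this

theorem cop_ab (ht : t ≠ 0) (h : D.U x = D.V x + C t) : IsCoprime (D.a x) (D.b x) :=
  ((cop_UV ht h).of_isCoprime_of_dvd_left (dvd_of_fa _ D.hmA _)).of_isCoprime_of_dvd_right
    (dvd_of_fa _ D.hmB _)

theorem n_unit (D : Dat α β) : IsUnit (C ((D.k + D.l + 1 : ℕ) : ℝ)) :=
  isUnit_C.2 (isUnit_iff_ne_zero.2 (Nat.cast_ne_zero.2 (Nat.succ_ne_zero (D.k + D.l))))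

theorem Fib.sepA (ht : t ≠ 0) (h : Fib D x t) :
    (∀ i, (D.A x i).Separable) ∧ ∀ i j, i ≠ j → IsCoprime (D.A x i) (D.A x j) := by
  refine sep_cop D.muA (D.A x) fun i => ?_
  have h1 : IsCoprime (D.A x i) (D.b x) :=
    ((cop_UV ht h.uv).of_isCoprime_of_dvd_left (dvd_of_A _ D.hmA _ i)).of_isCoprime_of_dvd_right
      (dvd_of_fa _ D.hmB _)
  have h2 : D.NA x = C ((D.k + D.l + 1 : ℕ) : ℝ) * D.b x := sub_eq_zero.1 h.ea
  change IsCoprime _ (D.NA x)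
  rw [h2]
  exact (isCoprime_mul_unit_left_right (n_unit D) _ _).2 h1

theorem Fib.sepB (ht : t ≠ 0) (h : Fib D x t) :
    (∀ i, (D.B x i).Separable) ∧ ∀ i j, i ≠ j → IsCoprime (D.B x i) (D.B x j) := by
  refine sep_cop D.muB (D.B x) fun i => ?_
  have h1 : IsCoprime (D.B x i) (D.a x) :=
    ((cop_UV ht h.uv).symm.of_isCoprime_of_dvd_left (dvd_of_A _ D.hmB _ i)).of_isCoprime_of_dvd_right
      (dvd_of_fa _ D.hmA _)
  have h2 : D.NB x = C ((D.k + D.l + 1 : ℕ) : ℝ) * D.a x := sub_eq_zero.1 h.eb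
  change IsCoprime _ (D.NB x)
  rw [h2]
  exact (isCoprime_mul_unit_left_right (n_unit D) _ _).2 h1

theorem Fib.rootsA (ht : t ≠ 0) (h : Fib D x t) :
    ∃ z : D.JA → ℂ, Function.Injective z ∧
      ∀ i, (D.A x i).map (algebraMap ℝ ℂ) = ∏ j : Fin (D.kA i), (X - C (z ⟨i, j⟩)) :=
  enum_roots _ (D.A_monic x) (D.A_deg x) (h.sepA ht).1 (h.sepA ht).2

theorem Fib.rootsB (ht : t ≠ 0) (h : Fib D x t) :
    ∃ z : D.JB → ℂ, Function.Injective z ∧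
      ∀ i, (D.B x i).map (algebraMap ℝ ℂ) = ∏ j : Fin (D.kB i), (X - C (z ⟨i, j⟩)) :=
  enum_roots _ (D.B_monic x) (D.B_deg x) (h.sepB ht).1 (h.sepB ht).2

theorem Fib.ramA (ht : t ≠ 0) (h : Fib D x t) :
    ramType (D.U x) 0 = (Finset.univ : Finset D.JA).val.map (fun p => D.muA p.1) := by
  obtain ⟨z, hz, hA⟩ := h.rootsA ht
  refine ramType_prodpow _ _ z hz _ (fun p => D.hmA p.1) ?_
  rw [Complex.ofReal_zero, C_0, sub_zero]
  exact fU_prodpow _ _ z hA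

theorem Fib.Vmap (h : Fib D x t) :
    (D.U x).map (algebraMap ℝ ℂ) - C (t : ℂ) = (D.V x).map (algebraMap ℝ ℂ) := by
  rw [h.uv]; simp

theorem Fib.ramB (ht : t ≠ 0) (h : Fib D x t) :
    ramType (D.U x) t = (Finset.univ : Finset D.JB).val.map (fun p => D.muB p.1) := by
  obtain ⟨z, hz, hA⟩ := h.rootsB ht
  refine ramType_prodpow _ _ z hz _ (fun p => D.hmB p.1) ?_
  rw [h.Vmap]
  exact fU_prodpow _ _ z hA

theorem Fib.inj (hA : Function.Injective D.muA) (hB : Function.Injective D.muB) (ht : t ≠ 0)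
    (h : Fib D x t) {y : D.II → ℝ} (h' : Fib D y t) (hU : D.U x = D.U y) : x = y := by
  have hV : D.V x = D.V y := by
    have h1 := h.uv
    rw [hU, h'.uv] at h1
    exact (add_right_cancel h1).symm
  obtain ⟨z, hz, hzA⟩ := h.rootsA ht
  obtain ⟨z', hz', hzA'⟩ := h'.rootsA ht
  obtain ⟨w, hw, hwB⟩ := h.rootsB ht
  obtain ⟨w', hw', hwB'⟩ := h'.rootsB ht
  have eA : ∀ i, D.A x i = D.A y i := by
    intro i
    apply Polynomial.map_injective (algebraMap ℝ ℂ) (algebraMap ℝ ℂ).injective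
    rw [hzA, hzA', ← Acan_eq D.muA hA D.hmA z hz, ← Acan_eq D.muA hA D.hmA z' hz',
      ← fU_prodpow _ _ z hzA, ← fU_prodpow _ _ z' hzA']
    exact congrArg (fun P : ℝ[X] => Acan (P.map (algebraMap ℝ ℂ)) (D.muA i)) hU
  have eB : ∀ i, D.B x i = D.B y i := by
    intro i
    apply Polynomial.map_injective (algebraMap ℝ ℂ) (algebraMap ℝ ℂ).injective
    rw [hwB, hwB', ← Acan_eq D.muB hB D.hmB w hw, ← Acan_eq D.muB hB D.hmB w' hw',
      ← fU_prodpow _ _ w hwB, ← fU_prodpow _ _ w' hwB']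
    exact congrArg (fun P : ℝ[X] => Acan (P.map (algebraMap ℝ ℂ)) (D.muB i)) hV
  funext p
  rcases p with ⟨i, j⟩ | ⟨i, j⟩
  · have := congrArg (fun P => P.coeff (j : ℕ)) (eA i)
    simp only [Dat.A, polyA_coeff] at this
    exact this
  · have := congrArg (fun P => P.coeff (j : ℕ)) (eB i)
    simp only [Dat.B, polyA_coeff] at this
    exact this

theorem exists_fib (D : Dat α β) (hA : Function.Injective D.muA) (hB : Function.Injective D.muB)
    (ht : t ≠ 0)
    (P : ℝ[X]) (hP : P.Monic) (hd : 0 < P.natDegree) (hc : P.coeff (D.k + D.l) = 0)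
    (h0 : ramType P 0 = (Finset.univ : Finset D.JA).val.map (fun p => D.muA p.1))
    (h1 : ramType P t = (Finset.univ : Finset D.JB).val.map (fun p => D.muB p.1)) :
    ∃ x, Fib D x t ∧ D.U x = P := by
  obtain ⟨A, hAm, hAd, hPA⟩ := exists_family D.muA hA P hP h0
  have hPt : (P - C t).Monic := by
    refine hP.sub_of_left ?_
    refine lt_of_le_of_lt degree_C_le ?_
    exact natDegree_pos_iff_degree_pos.1 hd
  obtain ⟨B, hBm, hBd, hPB⟩ := exists_family D.muB hB (P - C t) hPt ((ramType_sub P t).trans h1)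
  let x : D.II → ℝ := Sum.elim (fun p => (A p.1).coeff p.2) (fun p => (B p.1).coeff p.2)
  have hxA : D.A x = A := polyA_of_monic D.kA A hAm hAd
  have hxB : D.B x = B := polyA_of_monic D.kB B hBm hBd
  have hU : D.U x = P := by rw [Dat.U, hxA, hPA]
  have hV : D.V x = P - C t := by rw [Dat.V, hxB, hPB]
  have huv : D.U x = D.V x + C t := by rw [hU, hV]; ring
  have hcop := cop_ab ht huv
  have hder : D.a x * D.EA x = D.b x * D.EB x := by
    have := D.UV_der x
    rw [huv, add_sub_cancel_left, derivative_C] at this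
    exact (sub_eq_zero.1 this.symm)
  refine ⟨x, ⟨?_, ?_, huv, ?_⟩, hU⟩
  · have h2 : D.b x ∣ D.EA x := hcop.symm.dvd_of_dvd_mul_left ⟨_, hder⟩
    refine eq_zero_of_dvd_of_degree_lt h2 ?_
    rw [degree_eq_natDegree (D.b_monic x).ne_zero, D.b_deg]
    exact D.EA_deg x
  · have h2 : D.a x ∣ D.EB x := hcop.dvd_of_dvd_mul_left ⟨_, hder.symm⟩
    refine eq_zero_of_dvd_of_degree_lt h2 ?_
    rw [degree_eq_natDegree (D.a_monic x).ne_zero, D.a_deg]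
    exact D.EB_deg x
  · rw [hU, hc]
end fib

end TreeInv

namespace TreeInv

/-! ### Part 12 : lexicographic enumeration -/

theorem exists_enum {γ : Type} [Fintype γ] [LinearOrder γ] (kk : γ → ℕ) (N : ℕ)
    (h : ∑ i, kk i = N) : ∃ e : (Σ i, Fin (kk i)) ≃ Fin N,
      (∀ p q, p.1 < q.1 → e p < e q) ∧
      (∀ i (x y : Fin (kk i)), e ⟨i, x⟩ < e ⟨i, y⟩ ↔ x < y) := by
  let f : (Σ i, Fin (kk i)) ≃ (Σₗ i, Fin (kk i)) := toLex
  let _ : Fintype (Σₗ i, Fin (kk i)) := Fintype.ofEquiv _ f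
  have hc : Fintype.card (Σₗ i, Fin (kk i)) = N := by
    rw [← Fintype.card_congr f, Fintype.card_sigma]; simpa using h
  let g : Fin N ≃o (Σₗ i, Fin (kk i)) := Fintype.orderIsoFinOfCardEq _ hc
  refine ⟨f.trans g.symm.toEquiv, ?_, ?_⟩
  · intro p q hpq
    change g.symm (f p) < g.symm (f q)
    rw [g.symm.lt_iff_lt, Sigma.Lex.lt_def]
    exact Or.inl hpq
  · intro i x y
    change g.symm (f _) < g.symm (f _) ↔ _
    rw [g.symm.lt_iff_lt, Sigma.Lex.lt_def]
    constructor
    · rintro (h | ⟨h, h'⟩)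
      · exact absurd h (lt_irrefl i)
      · exact h'
    · intro h
      exact Or.inr ⟨rfl, h⟩

end TreeInv

namespace TreeInv

/-! ### Part 13 : the sign of the Jacobian -/

/-- disorders at the value zero -/
def Dis (P : ℝ[X]) : Set (ℝ × ℝ) :=
  {p | p.1 < p.2 ∧ P.eval p.1 = 0 ∧ P.eval p.2 = 0 ∧
    P.rootMultiplicity p.2 < P.rootMultiplicity p.1}

theorem sign_prod {J : Type*} [Fintype J] [DecidableEq J] (z : J → ℂ) (hz : Function.Injective z)
    (r : J → J → Prop) [DecidableRel r] (hr : ∀ p, ¬ r p p)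
    (τ : J → J) (hτ : ∀ p, z (τ p) = starRingEnd ℂ (z p)) (hrτ : ∀ p q, r p q → r (τ p) (τ q)) :
    ∃ c : ℝ, 0 < c ∧ (∏ p, ∏ q, if r p q then z q - z p else 1) =
      (c : ℂ) * (-1) ^ (Finset.univ.filter (fun s : J × J => r s.1 s.2 ∧ (z s.1).im = 0 ∧
        (z s.2).im = 0 ∧ (z s.2).re < (z s.1).re)).card := by
  have hττ : ∀ p, τ (τ p) = p := fun p => hz (by rw [hτ, hτ, Complex.conj_conj])
  have hrτ' : ∀ p q, r (τ p) (τ q) ↔ r p q := fun p q =>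
    ⟨fun h => by have := hrτ _ _ h; rwa [hττ, hττ] at this, hrτ p q⟩
  let f : J × J → ℂ := fun s => if r s.1 s.2 then z s.2 - z s.1 else 1
  have hf0 : ∀ s, f s ≠ 0 := by
    intro s
    simp only [f]
    split_ifs with h
    · intro h0
      have := hz (sub_eq_zero.1 h0)
      rw [this] at h
      exact hr _ h
    · exact one_ne_zero
  have hfτ : ∀ s, f (Prod.map τ τ s) = starRingEnd ℂ (f s) := by
    rintro ⟨p, q⟩
    simp only [f, Prod.map, hrτ']
    split_ifs
    · rw [hτ, hτ, map_sub]
    · simp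
  let g : J × J → ℂ := fun s => f s / (‖f s‖ : ℂ)
  have hg : ∀ s, g s * g (Prod.map τ τ s) = 1 := by
    intro s
    have hn : (‖f s‖ : ℂ) ≠ 0 := by exact_mod_cast norm_ne_zero_iff.2 (hf0 s)
    simp only [g, hfτ]
    rw [RCLike.norm_conj, div_mul_div_comm, Complex.mul_conj']
    field_simp
  have hprod : ∏ p, ∏ q, (if r p q then z q - z p else 1) = ∏ s, f s := by
    rw [Fintype.prod_prod_type]
  have hfix : ∀ s : J × J, Prod.map τ τ s = s ↔ ((z s.1).im = 0 ∧ (z s.2).im = 0) := by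
    rintro ⟨p, q⟩
    have : ∀ p, τ p = p ↔ (z p).im = 0 := by
      intro p
      rw [← hz.eq_iff, hτ, Complex.conj_eq_iff_im]
    simp only [Prod.map, Prod.mk.injEq, this]
  refine ⟨∏ s, ‖f s‖, Finset.prod_pos fun s _ => norm_pos_iff.2 (hf0 s), ?_⟩
  have h1 : ∏ s, f s = ((∏ s, ‖f s‖ : ℝ) : ℂ) * ∏ s, g s := by
    rw [Complex.ofReal_prod, ← Finset.prod_mul_distrib]
    refine Finset.prod_congr rfl fun s _ => ?_
    have hn : (‖f s‖ : ℂ) ≠ 0 := by exact_mod_cast norm_ne_zero_iff.2 (hf0 s)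
    simp only [g]
    field_simp
  rw [hprod, h1]
  congr 1
  rw [← Finset.prod_filter_mul_prod_filter_not Finset.univ (fun s => Prod.map τ τ s = s)]
  have h2 : ∏ s ∈ Finset.univ.filter (fun s => ¬ Prod.map τ τ s = s), g s = 1 := by
    refine Finset.prod_involution (fun s _ => Prod.map τ τ s) ?_ ?_ ?_ ?_
    · intro s _; exact hg s
    · intro s hs _
      exact (Finset.mem_filter.1 hs).2
    · intro s hs
      refine Finset.mem_filter.2 ⟨Finset.mem_univ _, ?_⟩
      intro h
      apply (Finset.mem_filter.1 hs).2
      have := congrArg (Prod.map τ τ) h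
      simpa [Prod.map, hττ] using this
    · intro s hs
      simp [Prod.map, hττ]
  rw [h2, mul_one, ← Finset.prod_const]
  have h3 : ∀ s ∈ Finset.univ.filter (fun s => Prod.map τ τ s = s), g s =
      if (r s.1 s.2 ∧ (z s.1).im = 0 ∧
        (z s.2).im = 0 ∧ (z s.2).re < (z s.1).re) then -1 else 1 := by
    intro s hs
    obtain ⟨i1, i2⟩ := (hfix s).1 (Finset.mem_filter.1 hs).2
    by_cases hrs : r s.1 s.2
    · have e1 : f s = (((z s.2).re - (z s.1).re : ℝ) : ℂ) := by
        simp only [f, if_pos hrs]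
        apply Complex.ext <;> simp [i1, i2]
      have e0 : (z s.2).re - (z s.1).re ≠ 0 := by
        intro h; apply hf0 s; rw [e1, h]; simp
      have e0' : (((z s.2).re - (z s.1).re : ℝ) : ℂ) ≠ 0 := by exact_mod_cast e0
      simp only [g]
      rw [e1, Complex.norm_real, Real.norm_eq_abs]
      split_ifs with hlt
      · rw [abs_of_neg (by linarith [hlt.2.2.2]), Complex.ofReal_neg, div_neg, div_self e0']
      · have : ¬ (z s.2).re < (z s.1).re := fun h => hlt ⟨hrs, i1, i2, h⟩
        rw [abs_of_nonneg (by linarith), div_self e0']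
    · rw [if_neg (fun h => hrs h.1)]
      simp [g, f, hrs]
  rw [Finset.prod_congr rfl h3, ← Finset.prod_filter, Finset.filter_filter]
  refine Finset.prod_congr ?_ fun _ _ => rfl
  ext s
  simp only [Finset.mem_filter, Finset.mem_univ, true_and, hfix]
  tauto

section side
variable {γ : Type} [Fintype γ] [LinearOrder γ] {kk : γ → ℕ}

theorem exists_tau (A : γ → ℝ[X]) (z : (Σ i, Fin (kk i)) → ℂ)
    (h : ∀ i, (A i).map (algebraMap ℝ ℂ) = ∏ j : Fin (kk i), (X - C (z ⟨i, j⟩))) :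
    ∃ τ : (Σ i, Fin (kk i)) → (Σ i, Fin (kk i)),
      (∀ p, z (τ p) = starRingEnd ℂ (z p)) ∧ ∀ p, (τ p).1 = p.1 := by
  have : ∀ p : (Σ i, Fin (kk i)), ∃ q : (Σ i, Fin (kk i)), z q = starRingEnd ℂ (z p) ∧ q.1 = p.1 := by
    rintro ⟨i, j⟩
    have h1 : ((A i).map (algebraMap ℝ ℂ)).eval (z ⟨i, j⟩) = 0 := by
      rw [h, eval_prod]
      exact Finset.prod_eq_zero (Finset.mem_univ j) (by simp)
    have h2 : ((A i).map (algebraMap ℝ ℂ)).eval (starRingEnd ℂ (z ⟨i, j⟩)) = 0 := by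
      conv_lhs => rw [← conj_map_real]
      rw [eval_map_apply, h1, map_zero]
    rw [h, eval_prod, Finset.prod_eq_zero_iff] at h2
    obtain ⟨j', _, hj'⟩ := h2
    refine ⟨⟨i, j'⟩, ?_, rfl⟩
    rw [eval_sub, eval_X, eval_C] at hj'
    exact (sub_eq_zero.1 hj').symm
  choose τ h1 h2 using this
  exact ⟨τ, h1, h2⟩

theorem dis_card (mu : γ → ℕ) (hpos : ∀ i, 0 < mu i) (hmu : StrictMono mu) (P : ℝ[X]) (z : (Σ i, Fin (kk i)) → ℂ)
    (hz : Function.Injective z)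
    (h : P.map (algebraMap ℝ ℂ) = ∏ p : (Σ i, Fin (kk i)), (X - C (z p)) ^ mu p.1) :
    (Dis P).Finite ∧ Nat.card (Dis P) = (Finset.univ.filter
      (fun s : (Σ i, Fin (kk i)) × (Σ i, Fin (kk i)) => s.1.1 < s.2.1 ∧ (z s.1).im = 0 ∧
        (z s.2).im = 0 ∧ (z s.2).re < (z s.1).re)).card := by
  have hrm : ∀ (p : (Σ i, Fin (kk i))) (x : ℝ), z p = x → P.rootMultiplicity x = mu p.1 := by
    intro p x hx
    rw [eq_rootMultiplicity_map (algebraMap ℝ ℂ).injective, h]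
    rw [← rm_prodpow z hz (fun p => mu p.1) p, hx]
    rfl
  have hev : ∀ x : ℝ, P.eval x = 0 ↔ ∃ p, z p = x := by
    intro x
    have : (P.map (algebraMap ℝ ℂ)).eval (x : ℂ) = 0 ↔ P.eval x = 0 := by
      rw [show (x : ℂ) = algebraMap ℝ ℂ x from rfl, eval_map_apply]
      simp
    rw [← this, h, eval_prod, Finset.prod_eq_zero_iff]
    constructor
    · rintro ⟨p, _, hp⟩
      rw [eval_pow, eval_sub, eval_X, eval_C] at hp
      exact ⟨p, (sub_eq_zero.1 (pow_eq_zero_iff (hpos _).ne' |>.1 hp)).symm⟩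
    · rintro ⟨p, hp⟩
      refine ⟨p, Finset.mem_univ _, ?_⟩
      rw [eval_pow, eval_sub, eval_X, eval_C, hp, sub_self, zero_pow (hpos _).ne']
  set S := (Finset.univ.filter
      (fun s : (Σ i, Fin (kk i)) × (Σ i, Fin (kk i)) => s.1.1 < s.2.1 ∧ (z s.1).im = 0 ∧
        (z s.2).im = 0 ∧ (z s.2).re < (z s.1).re)) with hS
  have himg : Dis P = (fun s : (Σ i, Fin (kk i)) × (Σ i, Fin (kk i)) => ((z s.2).re, (z s.1).re)) '' (S : Set _) := by
    ext ⟨x, y⟩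
    simp only [Dis, Set.mem_ofPred_eq, Set.mem_image, hev]
    constructor
    · rintro ⟨hxy, ⟨p, hp⟩, ⟨q, hq⟩, hlt⟩
      rw [hrm p x hp, hrm q y hq] at hlt
      refine ⟨(q, p), ?_, ?_⟩
      · rw [hS]
        simp only [Finset.coe_filter, Finset.mem_univ, true_and, Set.mem_ofPred_eq]
        refine ⟨hmu.lt_iff_lt.1 hlt, ?_, ?_, ?_⟩ <;> simp [hp, hq, hxy]
      · simp [hp, hq]
    · rintro ⟨⟨q, p⟩, hs, he⟩
      rw [hS] at hs
      simp only [Finset.coe_filter, Finset.mem_univ, true_and, Set.mem_ofPred_eq] at hs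
      simp only [Prod.mk.injEq] at he
      obtain ⟨rfl, rfl⟩ := he
      have e1 : z q = ((z q).re : ℂ) := Complex.ext (by simp) (by simp [hs.2.1])
      have e2 : z p = ((z p).re : ℂ) := Complex.ext (by simp) (by simp [hs.2.2.1])
      refine ⟨hs.2.2.2, ⟨p, e2⟩, ⟨q, e1⟩, ?_⟩
      rw [hrm p _ e2, hrm q _ e1]
      exact hmu hs.1
  constructor
  · rw [himg]; exact S.finite_toSet.image _
  · rw [Nat.card_coe_set_eq, himg, Set.InjOn.ncard_image, Set.ncard_coe_finset]
    rintro ⟨p, q⟩ hs ⟨p', q'⟩ hs' he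
    rw [hS] at hs hs'
    simp only [Finset.coe_filter, Finset.mem_univ, true_and, Set.mem_ofPred_eq] at hs hs'
    simp only [Prod.mk.injEq] at he
    refine Prod.ext (hz (Complex.ext he.2 ?_)) (hz (Complex.ext he.1 ?_))
    · rw [hs.2.1, hs'.2.1]
    · rw [hs.2.2.1, hs'.2.2.1]

/-- sign constant -/
noncomputable def sgConst (kk : γ → ℕ) : ℝ :=
  ∏ p : (Σ i, Fin (kk i)), ∏ q : (Σ i, Fin (kk i)), if p.1 < q.1 then (-1 : ℝ) else 1

theorem sgConst_ne (kk : γ → ℕ) : sgConst kk ≠ 0 := by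
  unfold sgConst
  refine Finset.prod_ne_zero_iff.2 fun p _ => Finset.prod_ne_zero_iff.2 fun q _ => ?_
  split_ifs <;> norm_num

theorem side_sign (mu : γ → ℕ) (hpos : ∀ i, 0 < mu i) (hmu : StrictMono mu) (A : γ → ℝ[X])
    (z : (Σ i, Fin (kk i)) → ℂ) (hz : Function.Injective z)
    (h : ∀ i, (A i).map (algebraMap ℝ ℂ) = ∏ j : Fin (kk i), (X - C (z ⟨i, j⟩)))
    {N : ℕ} (e : (Σ i, Fin (kk i)) ≃ Fin N) (he1 : ∀ p q, p.1 < q.1 → e p < e q)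
    (he2 : ∀ i (x y : Fin (kk i)), e ⟨i, x⟩ < e ⟨i, y⟩ ↔ x < y)
    (Lq : (Σ i, Fin (kk i)) → ℝ[X])
    (hLq : ∀ q, Lq q = C (mu q.1 : ℝ) * X ^ (q.2 : ℕ) * ∏ i ∈ Finset.univ.erase q.1, A i)
    (hLd : ∀ q, (Lq q).natDegree < N) :
    (Dis (fU mu A)).Finite ∧ ∃ c : ℝ, 0 < c ∧
      (Matrix.of fun p q : (Σ i, Fin (kk i)) => (Lq q).coeff (e p)).det
        = c * sgConst kk * (-1) ^ Nat.card (Dis (fU mu A)) := by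
  obtain ⟨hfin, hcard⟩ := dis_card mu hpos hmu (fU mu A) z hz (fU_prodpow mu A z h)
  refine ⟨hfin, ?_⟩
  obtain ⟨τ, hτ1, hτ2⟩ := exists_tau A z h
  obtain ⟨c, hc, hprod⟩ := sign_prod z hz (fun p q => p.1 < q.1) (fun p => lt_irrefl _) τ hτ1
    (fun p q hpq => by rw [hτ2, hτ2]; exact hpq)
  refine ⟨(∏ p : (Σ i, Fin (kk i)), (mu p.1 : ℝ)) * c,
    mul_pos (Finset.prod_pos fun p _ => by exact_mod_cast hpos p.1) hc, ?_⟩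
  apply Complex.ofReal_injective
  have hd := detL (mu := mu) z hz e he1 he2 (fun i => (A i).map (algebraMap ℝ ℂ)) h
    ((Matrix.of fun p q : (Σ i, Fin (kk i)) => (Lq q).coeff (e p)).map (algebraMap ℝ ℂ))
    (fun q => (Lq q).map (algebraMap ℝ ℂ))
    (fun q => by rw [hLq]; simp [Polynomial.map_prod])
    (fun q => by rw [natDegree_map]; exact hLd q)
    (fun p q => by simp)
  refine ((algebraMap ℝ ℂ).map_det _).trans (hd.trans ?_)
  have hsg : ((sgConst kk : ℝ) : ℂ) = ∏ p : (Σ i, Fin (kk i)), ∏ q : (Σ i, Fin (kk i)),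
      if p.1 < q.1 then (-1 : ℂ) else 1 := by
    rw [sgConst, Complex.ofReal_prod]
    refine Finset.prod_congr rfl fun p _ => ?_
    rw [Complex.ofReal_prod]
    refine Finset.prod_congr rfl fun q _ => ?_
    split_ifs <;> simp
  rw [hprod, hcard, ← hsg]
  push_cast
  ring

theorem L_deg (mu : γ → ℕ) (A : γ → ℝ[X]) (hA : ∀ i, (A i).Monic)
    (hd : ∀ i, (A i).natDegree = kk i) (N : ℕ) (hN : ∑ i, kk i = N) (q : Σ i, Fin (kk i)) :
    (C (mu q.1 : ℝ) * X ^ (q.2 : ℕ) * ∏ i ∈ Finset.univ.erase q.1, A i).natDegree < N := by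
  have h1 : (∏ i ∈ Finset.univ.erase q.1, A i).natDegree = ∑ i ∈ Finset.univ.erase q.1, kk i := by
    rw [natDegree_prod_of_monic _ _ fun i _ => hA i]
    exact Finset.sum_congr rfl fun i _ => hd i
  have h2 := Finset.add_sum_erase Finset.univ kk (Finset.mem_univ q.1)
  have h3 : (C (mu q.1 : ℝ) * X ^ (q.2 : ℕ)).natDegree ≤ (q.2 : ℕ) := natDegree_C_mul_X_pow_le _ _
  have h4 := natDegree_mul_le (p := C (mu q.1 : ℝ) * X ^ (q.2 : ℕ))
    (q := ∏ i ∈ Finset.univ.erase q.1, A i)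
  have h5 := q.2.2
  omega
end side

section dat
variable {α β : Type} [Fintype α] [Fintype β] [LinearOrder α] [LinearOrder β]
variable {D : Dat α β} {x : D.II → ℝ} {t : ℝ}

theorem Fib.disorders_eq (ht : t ≠ 0) (h : Fib D x t) :
    disorders (D.U x) = Dis (D.U x) ∪ Dis (D.V x) ∧ Disjoint (Dis (D.U x)) (Dis (D.V x)) := by
  have hV : D.U x - C t = D.V x := by rw [h.uv]; ring
  have hVe : ∀ y, (D.V x).eval y = (D.U x).eval y - t := by
    intro y; rw [h.uv]; simp
  constructor
  · ext ⟨x1, x2⟩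
    simp only [disorders, Dis, Set.mem_ofPred_eq, Set.mem_union]
    constructor
    · rintro ⟨hlt, heq, hrm⟩
      have hne : D.U x - C ((D.U x).eval x1) ≠ 0 := by
        intro h0
        have := congrArg natDegree (sub_eq_zero.1 h0)
        rw [D.U_deg, natDegree_C] at this
        omega
      have h2 : 0 < (D.U x - C ((D.U x).eval x2)).rootMultiplicity x2 := by
        rw [← heq, rootMultiplicity_pos hne]
        simp [heq]
      have h1 : 1 < (D.U x - C ((D.U x).eval x1)).rootMultiplicity x1 := by omega
      rw [one_lt_rootMultiplicity_iff_isRoot hne] at h1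
      have h3 := h1.2
      have hNA : D.NA x = C ((D.k + D.l + 1 : ℕ) : ℝ) * D.b x := sub_eq_zero.1 h.ea
      rw [derivative_sub, derivative_C, sub_zero, D.U_der, hNA, IsRoot.def, eval_mul, eval_mul,
        eval_C] at h3
      have hn : ((D.k + D.l + 1 : ℕ) : ℝ) ≠ 0 := Nat.cast_ne_zero.2 (Nat.succ_ne_zero _)
      rcases mul_eq_zero.1 h3 with h4 | h4
      · left
        have h5 : (D.U x).eval x1 = 0 := eval_eq_zero_of_dvd_of_eval_eq_zero (dvd_of_fa _ D.hmA _) h4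
        have h6 := heq.symm.trans h5
        rw [h5, h6, C_0, sub_zero] at hrm
        exact ⟨hlt, h5, h6, hrm⟩
      · right
        have h4' := (mul_eq_zero.1 h4).resolve_left hn
        have h5 : (D.V x).eval x1 = 0 := eval_eq_zero_of_dvd_of_eval_eq_zero (dvd_of_fa _ D.hmB _) h4'
        have h6 : (D.U x).eval x1 = t := by rw [hVe] at h5; linarith
        have h7 := heq.symm.trans h6
        rw [h6, h7, hV] at hrm
        exact ⟨hlt, h5, by rw [hVe, h7, sub_self], hrm⟩
    · rintro (⟨h1, h2, h3, h4⟩ | ⟨h1, h2, h3, h4⟩)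
      · refine ⟨h1, h2.trans h3.symm, ?_⟩
        rw [h2, h3, C_0, sub_zero]
        exact h4
      · rw [hVe] at h2 h3
        have h2' : (D.U x).eval x1 = t := by linarith
        have h3' : (D.U x).eval x2 = t := by linarith
        refine ⟨h1, h2'.trans h3'.symm, ?_⟩
        rw [h2', h3', hV]
        exact h4
  · rw [Set.disjoint_left]
    rintro ⟨x1, x2⟩ ⟨_, h1, _⟩ ⟨_, h2, _⟩
    simp only at h1 h2
    rw [hVe, h1] at h2
    exact ht (by linarith)

theorem jac_sign (D : Dat α β) (hA : StrictMono D.muA) (hB : StrictMono D.muB) :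
    ∃ (e : D.II ≃ OM D.k D.l) (σ : ℝ), σ ≠ 0 ∧ ∀ (t : ℝ) (x : D.II → ℝ), t ≠ 0 → Fib D x t →
      jac (D.H e) x ≠ 0 ∧
      Real.sign (jac (D.H e) x) = Real.sign σ * ((epsilonP (D.U x) : ℤ) : ℝ) := by
  obtain ⟨eA, hA1, hA2⟩ := exists_enum D.kA (D.k + 1) D.hkA
  obtain ⟨eB, hB1, hB2⟩ := exists_enum D.kB (D.l + 1) D.hkB
  obtain ⟨C0, hC0, hjac⟩ := jac_eq D eA eB
  refine ⟨D.e eA eB, C0 * (sgConst D.kA * sgConst D.kB),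
    mul_ne_zero hC0 (mul_ne_zero (sgConst_ne _) (sgConst_ne _)), ?_⟩
  intro t x ht h
  obtain ⟨z, hz, hzA⟩ := h.rootsA ht
  obtain ⟨w, hw, hwB⟩ := h.rootsB ht
  obtain ⟨fA, cA, hcA, dA⟩ := side_sign D.muA D.hmA hA (D.A x) z hz hzA eA hA1 hA2 (LA D x)
    (fun q => rfl) (L_deg D.muA (D.A x) (D.A_monic x) (D.A_deg x) _ D.hkA)
  obtain ⟨fB, cB, hcB, dB⟩ := side_sign D.muB D.hmB hB (D.B x) w hw hwB eB hB1 hB2 (LB D x)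
    (fun q => rfl) (L_deg D.muB (D.B x) (D.B_monic x) (D.B_deg x) _ D.hkB)
  obtain ⟨hd1, hd2⟩ := h.disorders_eq ht
  have hcard : Nat.card (disorders (D.U x)) = Nat.card (Dis (fU D.muA (D.A x)))
      + Nat.card (Dis (fU D.muB (D.B x))) := by
    rw [hd1, Nat.card_coe_set_eq, Set.ncard_union_eq hd2 fA fB]
    rfl
  have hj := hjac x h.ea h.eb (cop_ab ht h.uv)
  rw [dA, dB] at hj
  have heps : ((epsilonP (D.U x) : ℤ) : ℝ) = (-1) ^ Nat.card (Dis (fU D.muA (D.A x)))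
      * (-1) ^ Nat.card (Dis (fU D.muB (D.B x))) := by
    rw [epsilonP, hcard, pow_add]; push_cast; rfl
  have hj2 : jac (D.H (D.e eA eB)) x = (cA * cB) * ((C0 * (sgConst D.kA * sgConst D.kB)) *
      ((epsilonP (D.U x) : ℤ) : ℝ)) := by
    rw [hj, heps]; ring
  have he : ((epsilonP (D.U x) : ℤ) : ℝ) = 1 ∨ ((epsilonP (D.U x) : ℤ) : ℝ) = -1 := by
    rw [epsilonP]; push_cast; exact neg_one_pow_eq_or ℝ _
  have hσ : C0 * (sgConst D.kA * sgConst D.kB) ≠ 0 :=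
    mul_ne_zero hC0 (mul_ne_zero (sgConst_ne _) (sgConst_ne _))
  have hcc : 0 < cA * cB := mul_pos hcA hcB
  generalize C0 * (sgConst D.kA * sgConst D.kB) = s at *
  rw [hj2]
  constructor
  · refine mul_ne_zero hcc.ne' (mul_ne_zero hσ ?_)
    rcases he with he | he <;> rw [he] <;> norm_num
  · have hsm : ∀ y : ℝ, Real.sign (cA * cB * y) = Real.sign y := by
      intro y
      rcases lt_trichotomy y 0 with hy | hy | hy
      · rw [Real.sign_of_neg hy, Real.sign_of_neg (mul_neg_of_pos_of_neg hcc hy)]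
      · rw [hy, mul_zero]
      · rw [Real.sign_of_pos hy, Real.sign_of_pos (mul_pos hcc hy)]
    rw [hsm]
    rcases he with he | he <;> rw [he]
    · simp
    · rw [mul_neg_one, mul_neg_one, Real.sign_neg]
end dat

end TreeInv

namespace TreeInv

/-! ### Part 14 : assembly -/

theorem disorders_neg (P : ℝ[X]) : disorders (-P) = disorders P := by
  have h : ∀ (w x : ℝ), (-P - C (-w)).rootMultiplicity x = (P - C w).rootMultiplicity x := by
    intro w x
    have : -P - C (-w) = C (-1) * (P - C w) := by simp; ring
    rw [this, ← count_roots, ← count_roots, roots_C_mul _ (by simp)]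
  ext ⟨x, y⟩
  simp only [disorders, Set.mem_ofPred_eq, eval_neg, h, neg_inj]

theorem epsilonP_neg (P : ℝ[X]) : epsilonP (-P) = epsilonP P := by
  unfold epsilonP; rw [disorders_neg]

section dat
variable {α β : Type} [Fintype α] [Fintype β] [LinearOrder α] [LinearOrder β]
variable (D : Dat α β)

/-- the set of polynomials with the given data -/
def SS (t : ℝ) : Set ℝ[X] :=
  {P | P.natDegree = D.k + D.l + 1 ∧ P.Monic ∧ P.coeff (D.k + D.l) = 0 ∧
    ramType P 0 = (Finset.univ : Finset D.JA).val.map (fun p => D.muA p.1) ∧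
    ramType P t = (Finset.univ : Finset D.JB).val.map (fun p => D.muB p.1)}

theorem SS_eq (hA : StrictMono D.muA) (hB : StrictMono D.muB) (t : ℝ) (ht : t ≠ 0) :
    SS D t = D.U '' {x | Fib D x t} := by
  ext P
  simp only [SS, Set.mem_ofPred_eq, Set.mem_image]
  constructor
  · rintro ⟨h1, h2, h3, h4, h5⟩
    exact exists_fib D hA.injective hB.injective ht P h2 (by omega) h3 h4 h5
  · rintro ⟨x, hx, rfl⟩
    exact ⟨D.U_deg x, D.U_monic x, hx.u0, hx.ramA ht, hx.ramB ht⟩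

theorem hmap_fib (e : D.II ≃ OM D.k D.l) (x : D.II → ℝ) (t : ℝ) :
    hmap (D.H e) x = Pi.single (e.symm (Sum.inl (Sum.inr ()))) t ↔ Fib D x t := by
  have h0 : ∀ s, D.out x s = hmap (D.H e) x (e.symm s) := by
    intro s; rw [D.hmap_H, Equiv.apply_symm_apply]
  rw [fib_iff]
  constructor
  · intro h
    simp only [h0, h, Pi.single_apply, e.symm.injective.eq_iff]
    simp
  · rintro ⟨h1, h2, h3⟩
    funext i
    simp only [D.hmap_H, Pi.single_apply, Equiv.eq_symm_apply]
    rcases hs : e i with ((s | s) | s) | s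
    · simpa using h1 (Sum.inl s)
    · simpa using h1 (Sum.inr s)
    · simpa using h2
    · simpa using h3

theorem main_D (hA : StrictMono D.muA) (hB : StrictMono D.muB) :
    (SS D 1).Finite ∧ (SS D (-1)).Finite ∧
      ∑ᶠ P ∈ SS D 1, epsilonP P = ∑ᶠ P ∈ SS D (-1), epsilonP P := by
  obtain ⟨e, σ, hσ, hs⟩ := jac_sign D hA hB
  obtain ⟨f1, f2, hsum⟩ := degree_inv (D.H e) (e.symm (Sum.inl (Sum.inr ()))) (D.proper e)
    (fun s hs0 x hx => (hs s x hs0 ((hmap_fib D e x s).1 hx)).1)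
  have e1 : ∀ t, {x | hmap (D.H e) x = Pi.single (e.symm (Sum.inl (Sum.inr ()))) t}
      = {x | Fib D x t} := by
    intro t; ext x; exact hmap_fib D e x t
  have h1 : (1 : ℝ) ≠ 0 := one_ne_zero
  have h2 : (-1 : ℝ) ≠ 0 := by norm_num
  have g1 : {x | Fib D x 1}.Finite := by rw [← e1]; exact f1
  have g2 : {x | Fib D x (-1)}.Finite := by rw [← e1]; exact f2
  have inj : ∀ t : ℝ, t ≠ 0 → Set.InjOn D.U {x | Fib D x t} := fun t ht x hx y hy hxy =>
    Fib.inj hA.injective hB.injective ht hx hy hxy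
  rw [SS_eq D hA hB 1 h1, SS_eq D hA hB (-1) h2]
  refine ⟨g1.image _, g2.image _, ?_⟩
  rw [finsum_mem_image (inj 1 h1), finsum_mem_image (inj (-1) h2),
    finsum_mem_eq_finite_toFinset_sum _ g1, finsum_mem_eq_finite_toFinset_sum _ g2]
  have k1 : ∑ x ∈ f1.toFinset, Real.sign (jac (D.H e) x)
      = Real.sign σ * ((∑ x ∈ g1.toFinset, epsilonP (D.U x) : ℤ) : ℝ) := by
    rw [Int.cast_sum, Finset.mul_sum]
    refine Finset.sum_congr (by ext x; simp [hmap_fib]) fun x hx => ?_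
    exact (hs 1 x h1 (g1.mem_toFinset.1 hx)).2
  have k2 : ∑ x ∈ f2.toFinset, Real.sign (jac (D.H e) x)
      = Real.sign σ * ((∑ x ∈ g2.toFinset, epsilonP (D.U x) : ℤ) : ℝ) := by
    rw [Int.cast_sum, Finset.mul_sum]
    refine Finset.sum_congr (by ext x; simp [hmap_fib]) fun x hx => ?_
    exact (hs (-1) x h2 (g2.mem_toFinset.1 hx)).2
  rw [k1, k2] at hsum
  have hσ' : Real.sign σ ≠ 0 := by rwa [Ne, Real.sign_eq_zero_iff]
  exact_mod_cast mul_left_cancel₀ hσ' hsum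
end dat

theorem mult_map (M : Multiset ℕ) :
    (Finset.univ : Finset (Σ i : M.toFinset, Fin (M.count (i : ℕ)))).val.map
      (fun p => (p.1 : ℕ)) = M := by
  ext m
  rw [Multiset.count_map, ← Finset.filter_val]
  change (Finset.filter _ _).card = _
  by_cases hm : m ∈ M.toFinset
  · have : (Finset.univ.filter (fun p : (Σ i : M.toFinset, Fin (M.count (i : ℕ))) => m = (p.1 : ℕ)))
        = Finset.univ.map (Function.Embedding.sigmaMk
          (β := fun i : M.toFinset => Fin (M.count (i : ℕ))) ⟨m, hm⟩) := by
      ext ⟨i', j⟩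
      simp only [Finset.mem_filter, Finset.mem_univ, true_and, Finset.mem_map,
        Function.Embedding.sigmaMk_apply]
      constructor
      · intro h
        have : i' = ⟨m, hm⟩ := Subtype.ext h.symm
        subst this
        exact ⟨j, rfl⟩
      · rintro ⟨a, ha⟩
        rw [Sigma.mk.injEq] at ha
        rw [← ha.1]
    rw [this]; simp
  · rw [Multiset.count_eq_zero.2 (fun h => hm (Multiset.mem_toFinset.2 h)), Finset.card_eq_zero,
      Finset.filter_eq_empty_iff]
    rintro ⟨i, j⟩ _ h
    simp only at h
    exact hm (h ▸ i.2)

theorem mult_card (M : Multiset ℕ) : ∑ i : M.toFinset, M.count (i : ℕ) = Multiset.card M := by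
  rw [Finset.sum_coe_sort M.toFinset (fun i => M.count i)]
  exact Multiset.toFinset_sum_count_eq M

theorem mult_sum (M : Multiset ℕ) : ∑ i : M.toFinset, (i : ℕ) * M.count (i : ℕ) = M.sum := by
  rw [Finset.sum_coe_sort M.toFinset (fun i => i * M.count i), Finset.sum_multiset_count]
  exact Finset.sum_congr rfl fun i _ => by rw [smul_eq_mul, mul_comm]

theorem card_le_of_part (n : ℕ) (M : Multiset ℕ) (h : IsPartitionOf n M) : Multiset.card M ≤ n := by
  have h1 : ∀ x ∈ M, 1 ≤ x := by
    intro x hx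
    rcases Nat.eq_zero_or_pos x with h0 | h0
    · exact absurd (h0 ▸ hx) h.2
    · exact h0
  have := Multiset.card_nsmul_le_sum h1
  rw [h.1] at this
  simpa using this

theorem card_pos_of_part (n : ℕ) (hn : 0 < n) (M : Multiset ℕ) (h : IsPartitionOf n M) :
    0 < Multiset.card M := by
  rw [Multiset.card_pos]
  rintro rfl
  have := h.1
  simp at this
  omega

/-- the data attached to two partitions -/
def theDat (k l : ℕ) (Mb Mw : Multiset ℕ) (hb : IsPartitionOf (k + l + 1) Mb)
    (hw : IsPartitionOf (k + l + 1) Mw) (cb : Multiset.card Mb = k + 1)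
    (cw : Multiset.card Mw = l + 1) : Dat Mb.toFinset Mw.toFinset where
  kA i := Mb.count (i : ℕ)
  muA i := i
  kB i := Mw.count (i : ℕ)
  muB i := i
  k := k
  l := l
  hmA i := Nat.pos_of_ne_zero fun h => hb.2 (h ▸ Multiset.mem_toFinset.1 i.2)
  hmB i := Nat.pos_of_ne_zero fun h => hw.2 (h ▸ Multiset.mem_toFinset.1 i.2)
  hkA := (mult_card Mb).trans cb
  hkB := (mult_card Mw).trans cw
  hA := (mult_sum Mb).trans hb.1
  hB := (mult_sum Mw).trans hw.1

theorem main_kl (k l : ℕ) (Mb Mw : Multiset ℕ) (hb : IsPartitionOf (k + l + 1) Mb)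
    (hw : IsPartitionOf (k + l + 1) Mw) (cb : Multiset.card Mb = k + 1)
    (cw : Multiset.card Mw = l + 1) (S : ℝ → Set ℝ[X])
    (hS : ∀ t, S t = {P | P.natDegree = k + l + 1 ∧ P.Monic ∧ P.coeff (k + l) = 0 ∧
      ramType P 0 = Mb ∧ ramType P t = Mw}) :
    (S 1).Finite ∧ (S (-1)).Finite ∧ ∑ᶠ P ∈ S 1, epsilonP P = ∑ᶠ P ∈ S (-1), epsilonP P := by
  have h := main_D (theDat k l Mb Mw hb hw cb cw) (fun _ _ h => h) (fun _ _ h => h)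
  have e : ∀ t, SS (theDat k l Mb Mw hb hw cb cw) t = S t := by
    intro t
    rw [hS]
    have e1 := mult_map Mb
    have e2 := mult_map Mw
    have : SS (theDat k l Mb Mw hb hw cb cw) t = {P | P.natDegree = k + l + 1 ∧ P.Monic ∧
      P.coeff (k + l) = 0 ∧ ramType P 0 = ((Finset.univ : Finset (Σ i : Mb.toFinset, Fin (Mb.count (i : ℕ)))).val.map
      (fun p => (p.1 : ℕ))) ∧ ramType P t = ((Finset.univ : Finset (Σ i : Mw.toFinset, Fin (Mw.count (i : ℕ)))).val.map
      (fun p => (p.1 : ℕ)))} := rfl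
    rw [this, e1, e2]
  rwa [e, e] at h

end TreeInv

/-- The invariance theorem for two branch points (the polynomial reformulation of the
black-and-white tree theorem): the signed count of polynomials
`X^n + a₂X^(n-2) + ⋯ + a_n` with ramification type `Λ_b` at `0` and `Λ_w` at `1` equals
the signed count of polynomials `-X^n + a₂X^(n-2) + ⋯ + a_n` with the same data. -/
theorem tree_invariance (n : ℕ) (hn : 0 < n)
    (Λb Λw : Multiset ℕ) (hΛb : IsPartitionOf n Λb) (hΛw : IsPartitionOf n Λw)
    (hsum : (n - Multiset.card Λb) + (n - Multiset.card Λw) = n - 1)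
    (Splus Sminus : Set (Polynomial ℝ))
    (hSplus : Splus = {P | IsNormalized n P ∧ ramType P 0 = Λb ∧ ramType P 1 = Λw})
    (hSminus : Sminus = {P | P.natDegree = n ∧ P.leadingCoeff = -1 ∧ P.coeff (n - 1) = 0 ∧
      ramType P 0 = Λb ∧ ramType P 1 = Λw}) :
    Splus.Finite ∧ Sminus.Finite ∧
      ∑ᶠ P ∈ Splus, epsilonP P = ∑ᶠ P ∈ Sminus, epsilonP P := by
  have c1 := TreeInv.card_le_of_part n Λb hΛb
  have c2 := TreeInv.card_le_of_part n Λw hΛw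
  have d1 := TreeInv.card_pos_of_part n hn Λb hΛb
  have d2 := TreeInv.card_pos_of_part n hn Λw hΛw
  obtain ⟨k, hk⟩ : ∃ k, Multiset.card Λb = k + 1 := ⟨Multiset.card Λb - 1, by omega⟩
  obtain ⟨l, hl⟩ : ∃ l, Multiset.card Λw = l + 1 := ⟨Multiset.card Λw - 1, by omega⟩
  have hnkl : n = k + l + 1 := by omega
  subst hnkl
  have hmain := TreeInv.main_kl k l Λb Λw hΛb hΛw hk hl _ (fun t => rfl)
  have hp : Splus = {P | P.natDegree = k + l + 1 ∧ P.Monic ∧ P.coeff (k + l) = 0 ∧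
      ramType P 0 = Λb ∧ ramType P 1 = Λw} := by
    rw [hSplus]
    ext P
    simp only [IsNormalized, Set.mem_ofPred_eq, Nat.add_sub_cancel, and_assoc]
  have hm : Sminus = (fun P => -P) '' {P : ℝ[X] | P.natDegree = k + l + 1 ∧ P.Monic ∧
      P.coeff (k + l) = 0 ∧ ramType P 0 = Λb ∧ ramType P (-1) = Λw} := by
    rw [hSminus]
    have r0 : ∀ P : ℝ[X], ramType (-P) 0 = ramType P 0 := by
      intro P
      have := TreeInv.ramType_neg P 0
      rwa [neg_zero] at this
    ext P
    simp only [Set.mem_ofPred_eq, Set.mem_image, Nat.add_sub_cancel]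
    constructor
    · rintro ⟨h1, h2, h3, h4, h5⟩
      refine ⟨-P, ⟨?_, ?_, ?_, ?_, ?_⟩, neg_neg P⟩
      · rw [natDegree_neg, h1]
      · rw [Monic, leadingCoeff_neg, h2, neg_neg]
      · rw [coeff_neg, h3, neg_zero]
      · rw [r0, h4]
      · rw [TreeInv.ramType_neg, h5]
    · rintro ⟨Q, ⟨h1, h2, h3, h4, h5⟩, rfl⟩
      refine ⟨?_, ?_, ?_, ?_, ?_⟩
      · rw [natDegree_neg, h1]
      · rw [leadingCoeff_neg, h2.leadingCoeff]
      · rw [coeff_neg, h3, neg_zero]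
      · rw [r0, h4]
      · rw [← h5, ← TreeInv.ramType_neg Q (-1), neg_neg]
  obtain ⟨m1, m2, m3⟩ := hmain
  rw [hp, hm]
  refine ⟨m1, m2.image _, ?_⟩
  rw [finsum_mem_image (neg_injective.injOn)]
  simp only [TreeInv.epsilonP_neg]
  exact m3
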